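/- arXiv:1112.2115 — 4 statements merged into one kernel-verified Lean document; each statement's English description precedes it below -/
import Mathlib

section
/- For every n ≥ 2, n²/5 ≤ f(n) ≤ ((n+2)² − k(n))/5, where k(n) equals 4, 4, 6, 5, 16 according as n mod 5 equals 0, 1, 2, 3, 4 (and ((n+2)² − k(n))/5 is an integer). -/
/-- A cell of the square grid. -/
abbrev Cell : Type := ℤ × ℤ

/-- Two cells are adjacent iff they differ by 1 in exactly one coordinate. -/
def Adj (p q : Cell) : Prop := |p.1 - q.1| + |p.2 - q.2| = 1

/-- A board: a finite nonempty set of cells, each adjacent to another cell of the board. -/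
def IsBoard (B : Set Cell) : Prop :=
  B.Finite ∧ B.Nonempty ∧ ∀ p ∈ B, ∃ q ∈ B, Adj p q

/-- A domino of `B`: a two-element subset of `B` whose cells are adjacent. -/
def IsDomino (B : Set Cell) (e : Finset Cell) : Prop :=
  ∃ p q : Cell, p ∈ B ∧ q ∈ B ∧ Adj p q ∧ e = {p, q}

/-- A domino covering of `B`: a finite set of dominoes of `B` whose union is `B`. -/
def IsDominoCovering (B : Set Cell) (D : Finset (Finset Cell)) : Prop :=
  (∀ e ∈ D, IsDomino B e) ∧ (⋃ e ∈ D, (↑e : Set Cell)) = B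

/-- A saturated domino covering: removing any domino leaves some cell uncovered. -/
def IsSaturatedCovering (B : Set Cell) (D : Finset (Finset Cell)) : Prop :=
  IsDominoCovering B D ∧ ∀ e ∈ D, (⋃ e' ∈ D.erase e, (↑e' : Set Cell)) ⊂ B

/-- `dNum B` is the maximum number of dominoes in a saturated domino covering of `B`. -/
noncomputable def dNum (B : Set Cell) : ℕ :=
  sSup {k : ℕ | ∃ D : Finset (Finset Cell), IsSaturatedCovering B D ∧ D.card = k}

/-- The X-pentomino centered at `c`: the cell `c` together with its four adjacent cells. -/
def Xpent (c : Cell) : Set Cell :=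
  {c, (c.1 + 1, c.2), (c.1 - 1, c.2), (c.1, c.2 + 1), (c.1, c.2 - 1)}

/-- A set of cells is connected under adjacency. -/
def ConnectedUnderAdj (F : Set Cell) : Prop :=
  ∀ p ∈ F, ∀ q ∈ F, Relation.ReflTransGen (fun a b => a ∈ F ∧ b ∈ F ∧ Adj a b) p q

/-- A fragment: a connected subset of some X-pentomino with at least two cells. -/
def IsFragment (F : Set Cell) : Prop :=
  (∃ c : Cell, F ⊆ Xpent c) ∧ 2 ≤ F.ncard ∧ ConnectedUnderAdj F

/-- A fragment tiling of `B`: a partition of `B` into pairwise disjoint fragments. -/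
def IsFragmentTiling (B : Set Cell) (T : Finset (Set Cell)) : Prop :=
  (∀ F ∈ T, IsFragment F) ∧
  (∀ F ∈ T, ∀ G ∈ T, F ≠ G → Disjoint F G) ∧
  (⋃ F ∈ T, F) = B

/-- `fNum B` is the minimum number of fragments in a fragment tiling of `B`. -/
noncomputable def fNum (B : Set Cell) : ℕ :=
  sInf {k : ℕ | ∃ T : Finset (Set Cell), IsFragmentTiling B T ∧ T.card = k}

/-- `xNum B` is the minimum number of X-pentominoes (centered anywhere, allowed to
overlap and to extend outside `B`) whose union covers `B`. -/
noncomputable def xNum (B : Set Cell) : ℕ :=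
  sInf {k : ℕ | ∃ C : Finset Cell, B ⊆ (⋃ c ∈ C, Xpent c) ∧ C.card = k}

/-- The `n × n` board `{0, …, n-1} × {0, …, n-1}`. -/
def Sq (n : ℕ) : Set Cell := {p : Cell | 0 ≤ p.1 ∧ p.1 < n ∧ 0 ≤ p.2 ∧ p.2 < n}

/-- The correction term `k(n)` depending on `n` mod 5. -/
def kCorr (n : ℕ) : ℕ :=
  match n % 5 with
  | 0 => 4
  | 1 => 4
  | 2 => 6
  | 3 => 5
  | _ => 16

/-- A star: contains its center and at least one other cell. -/
def IsStar (F : Set Cell) : Prop :=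
  ∃ e ∈ F, F ⊆ Xpent e ∧ ∃ q ∈ F, q ≠ e

/-- A tiling of `U` by stars. -/
def StarTiling (U : Set Cell) (T : Finset (Set Cell)) : Prop :=
  (∀ F ∈ T, IsStar F) ∧
  (∀ F ∈ T, ∀ G ∈ T, F ≠ G → Disjoint F G) ∧
  (⋃ F ∈ T, F) = U

theorem mem_Xpent_iff (c p : Cell) : p ∈ Xpent c ↔ p = c ∨ Adj c p := by
  obtain ⟨a, b⟩ := c
  obtain ⟨x, y⟩ := p
  simp only [Xpent, Set.mem_insert_iff, Set.mem_singleton_iff, Adj, Prod.mk.injEq]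
  rcases abs_cases (a - x) with h | h <;> rcases abs_cases (b - y) with h' | h' <;> omega

theorem adj_symm {p q : Cell} (h : Adj p q) : Adj q p := by
  unfold Adj at *
  rw [abs_sub_comm q.1, abs_sub_comm q.2]; exact h

theorem mem_Xpent_symm {c p : Cell} (h : p ∈ Xpent c) : c ∈ Xpent p := by
  rw [mem_Xpent_iff] at *
  rcases h with h | h
  · exact Or.inl h.symm
  · exact Or.inr (adj_symm h)

theorem Xpent_finite (c : Cell) : (Xpent c).Finite := by
  unfold Xpent; exact Set.toFinite _

theorem Xpent_ncard (c : Cell) : (Xpent c).ncard ≤ 5 := by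
  unfold Xpent
  refine (Set.ncard_insert_le _ _).trans ?_
  have h1 := Set.ncard_insert_le (c.1 + 1, c.2) {(c.1 - 1, c.2), (c.1, c.2 + 1), (c.1, c.2 - 1)}
  have h2 := Set.ncard_insert_le (c.1 - 1, c.2) {(c.1, c.2 + 1), (c.1, c.2 - 1)}
  have h3 := Set.ncard_insert_le (c.1, c.2 + 1) {(c.1, c.2 - 1)}
  have h4 := Set.ncard_singleton (c.1, c.2 - 1)
  omega

theorem IsStar.isFragment {F : Set Cell} (h : IsStar F) : IsFragment F := by
  obtain ⟨e, he, hF, q, hq, hqe⟩ := h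
  refine ⟨⟨e, hF⟩, ?_, ?_⟩
  · have hfin : F.Finite := (Xpent_finite e).subset hF
    have : 1 < F.ncard := (Set.one_lt_ncard hfin).2 ⟨q, hq, e, he, hqe⟩
    omega
  · intro a ha b hb
    have h1 : Relation.ReflTransGen (fun a b => a ∈ F ∧ b ∈ F ∧ Adj a b) a e := by
      rcases (mem_Xpent_iff e a).1 (hF ha) with h | h
      · rw [h]
      · exact Relation.ReflTransGen.single ⟨ha, he, adj_symm h⟩
    have h2 : Relation.ReflTransGen (fun a b => a ∈ F ∧ b ∈ F ∧ Adj a b) e b := by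
      rcases (mem_Xpent_iff e b).1 (hF hb) with h | h
      · rw [h]
      · exact Relation.ReflTransGen.single ⟨he, hb, h⟩
    exact h1.trans h2

open Classical in
theorem StarTiling.insert {U G : Set Cell} {T : Finset (Set Cell)} (h : StarTiling U T)
    (hG : IsStar G) (hd : Disjoint U G) : StarTiling (U ∪ G) (Insert.insert G T) := by
  obtain ⟨h1, h2, h3⟩ := h
  have h4 : ∀ F ∈ T, Disjoint F G := fun F hF =>
    hd.mono_left (by rw [← h3]; exact Set.subset_biUnion_of_mem (u := fun F => F) hF)
  refine ⟨?_, ?_, ?_⟩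
  · intro F hF
    rcases Finset.mem_insert.1 hF with rfl | hF
    · exact hG
    · exact h1 F hF
  · intro F hF F' hF' hne
    rcases Finset.mem_insert.1 hF with rfl | hFT <;> rcases Finset.mem_insert.1 hF' with rfl | hFT'
    · exact absurd rfl hne
    · exact (h4 _ hFT').symm
    · exact h4 _ hFT
    · exact h2 _ hFT _ hFT' hne
  · rw [Finset.set_biUnion_insert, h3, Set.union_comm]

open Classical in
theorem StarTiling.erase {U F : Set Cell} {T : Finset (Set Cell)} (h : StarTiling U T)
    (hF : F ∈ T) : StarTiling (U \ F) (T.erase F) := by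
  obtain ⟨h1, h2, h3⟩ := h
  refine ⟨fun G hG => h1 G (Finset.mem_of_mem_erase hG), fun G hG G' hG' =>
    h2 G (Finset.mem_of_mem_erase hG) G' (Finset.mem_of_mem_erase hG'), ?_⟩
  ext p
  rw [← h3]
  simp only [Set.mem_iUnion, Finset.mem_erase, Set.mem_sdiff]
  constructor
  · rintro ⟨G, ⟨hne, hG⟩, hp⟩
    exact ⟨⟨G, hG, hp⟩, fun hpF => Set.disjoint_left.1 (h2 G hG F hF hne) hp hpF⟩
  · rintro ⟨⟨G, hG, hp⟩, hpF⟩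
    exact ⟨G, ⟨fun h => hpF (h ▸ hp), hG⟩, hp⟩

open Classical in
/-- Attach new neighbours `M` of a covered cell `c`, at the cost of at most one more star. -/
theorem StarTiling.attach {U M : Set Cell} {T : Finset (Set Cell)} (h : StarTiling U T)
    {c : Cell} (hc : c ∈ U) (hM : M ⊆ Xpent c) (hne : M.Nonempty) (hd : Disjoint U M) :
    ∃ T', StarTiling (U ∪ M) T' ∧ T'.card ≤ T.card + 1 := by
  obtain ⟨F, hF, hcF⟩ : ∃ F ∈ T, c ∈ F := by
    rw [← h.2.2] at hc
    simpa using hc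
  have hFU : F ⊆ U := by
    rw [← h.2.2]; exact Set.subset_biUnion_of_mem (u := fun F => F) hF
  have hcM : c ∉ M := Set.disjoint_left.1 hd hc
  obtain ⟨m, hm⟩ := hne
  have hmc : m ≠ c := fun e => hcM (e ▸ hm)
  have hE := h.erase hF
  have hcard : (T.erase F).card + 1 = T.card := Finset.card_erase_add_one hF
  by_cases hS : F ⊆ Xpent c
  · refine ⟨Insert.insert (F ∪ M) (T.erase F), ?_, ?_⟩
    · have := hE.insert (G := F ∪ M) ⟨c, Or.inl hcF, Set.union_subset hS hM, m, Or.inr hm, hmc⟩ (by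
        rw [Set.disjoint_left] at *
        rintro p ⟨hp, hpF⟩ (h' | h')
        · exact hpF h'
        · exact hd hp h')
      have e : U \ F ∪ (F ∪ M) = U ∪ M := by
        rw [← Set.union_assoc, Set.diff_union_of_subset hFU]
      rwa [e] at this
    · have := Finset.card_insert_le (F ∪ M) (T.erase F)
      omega
  · obtain ⟨e, he, hFe, -⟩ := h.1 F hF
    have hec : e ≠ c := fun h' => hS (h' ▸ hFe)
    obtain ⟨q, hq, hqc⟩ := Set.not_subset.1 hS
    have hqe : q ≠ e := fun h' => hqc (h' ▸ mem_Xpent_symm (hFe hcF))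
    have hqc' : q ≠ c := fun h' => hqc (h' ▸ (mem_Xpent_iff _ _).2 (Or.inl rfl))
    have h1 := hE.insert (G := F \ {c}) ⟨e, ⟨he, hec⟩, Set.diff_subset.trans hFe, q, ⟨hq, hqc'⟩, hqe⟩
      (by
        rw [Set.disjoint_left]
        rintro p ⟨hp, hpF⟩ ⟨h', -⟩
        exact hpF h')
    have h2 := h1.insert (G := Insert.insert c M) ⟨c, Or.inl rfl,
        Set.insert_subset ((mem_Xpent_iff _ _).2 (Or.inl rfl)) hM, m, Or.inr hm, hmc⟩ (by
        rw [Set.disjoint_left] at *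
        rintro p (⟨hp, hpF⟩ | ⟨hp, hpc⟩) (h' | h')
        · exact hpF (h' ▸ hcF)
        · exact hd hp h'
        · exact hpc h'
        · exact hd (hFU hp) h')
    refine ⟨Insert.insert (Insert.insert c M) (Insert.insert (F \ {c}) (T.erase F)), ?_, ?_⟩
    · convert h2 using 1
      ext p
      by_cases hpc : p = c
      · simp [hpc, hc]
      · have := @hFU p
        simp only [Set.mem_union, Set.mem_sdiff, Set.mem_insert_iff, Set.mem_singleton_iff]
        tauto
    · have a1 := Finset.card_insert_le (Insert.insert c M) (Insert.insert (F \ {c}) (T.erase F))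
      have a2 := Finset.card_insert_le (F \ {c}) (T.erase F)
      omega

open Classical in
theorem exists_starTiling {B : Set Cell} (hB : ∀ p ∈ B, ∃ q ∈ B, Adj p q) (C : Finset Cell) :
    (∀ c ∈ C, c ∈ B) → ∃ U T, StarTiling U T ∧ T.card ≤ C.card ∧ U ⊆ B ∧
      ∀ c ∈ C, B ∩ Xpent c ⊆ U := by
  induction C using Finset.induction_on with
  | empty =>
    intro _
    exact ⟨∅, ∅, ⟨by simp, by simp, by simp⟩, by simp, by simp, by simp⟩
  | insert c C hcC ih =>
    intro hC
    obtain ⟨U, T, hT, hcard, hUB, hcov⟩ := ih (fun c hc => hC c (Finset.mem_insert_of_mem hc))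
    have hcB := hC c (Finset.mem_insert_self _ _)
    rw [Finset.card_insert_of_notMem hcC]
    set N := (B ∩ Xpent c) \ U with hN
    have hcc : c ∈ Xpent c := (mem_Xpent_iff _ _).2 (Or.inl rfl)
    have hNX : N ⊆ Xpent c := fun p hp => hp.1.2
    have hNB : N ⊆ B := fun p hp => hp.1.1
    have hdis : Disjoint U N := Set.disjoint_sdiff_right
    suffices hh : ∃ T', StarTiling (U ∪ N) T' ∧ T'.card ≤ T.card + 1 by
      obtain ⟨T', hT', hc'⟩ := hh
      refine ⟨U ∪ N, T', hT', by omega, Set.union_subset hUB hNB, ?_⟩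
      intro d hd
      rcases Finset.mem_insert.1 hd with rfl | hd
      · intro p hp
        by_cases hpU : p ∈ U
        · exact Or.inl hpU
        · exact Or.inr ⟨hp, hpU⟩
      · exact (hcov d hd).trans Set.subset_union_left
    rcases N.eq_empty_or_nonempty with h0 | hne
    · exact ⟨T, by rwa [h0, Set.union_empty], by omega⟩
    by_cases hcU : c ∈ U
    · exact hT.attach hcU hNX hne hdis
    · have hcN : c ∈ N := ⟨⟨hcB, hcc⟩, hcU⟩
      by_cases hq : ∃ q ∈ N, q ≠ c
      · exact ⟨_, hT.insert ⟨c, hcN, hNX, hq⟩ hdis, Finset.card_insert_le _ _⟩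
      · push Not at hq
        obtain ⟨d, hdB, hd⟩ := hB c hcB
        have hdX : d ∈ Xpent c := (mem_Xpent_iff _ _).2 (Or.inr hd)
        have hdc : d ≠ c := by
          rintro rfl
          simp [Adj] at hd
        have hdU : d ∈ U := by
          by_contra hdU
          exact hdc (hq d ⟨⟨hdB, hdX⟩, hdU⟩)
        refine hT.attach hdU ?_ hne hdis
        intro p hp
        rw [hq p hp]
        exact mem_Xpent_symm hdX

theorem exists_tiling {B : Set Cell} (hB : ∀ p ∈ B, ∃ q ∈ B, Adj p q) (C : Finset Cell)
    (hC : ∀ c ∈ C, c ∈ B) (hcov : ∀ p ∈ B, ∃ c ∈ C, p ∈ Xpent c) :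
    ∃ T, IsFragmentTiling B T ∧ T.card ≤ C.card := by
  obtain ⟨U, T, hT, hcard, hUB, hc⟩ := exists_starTiling hB C hC
  have : U = B := by
    apply Set.Subset.antisymm hUB
    intro p hp
    obtain ⟨c, hcC, hpc⟩ := hcov p hp
    exact hc c hcC ⟨hp, hpc⟩
  subst this
  exact ⟨T, ⟨fun F hF => (hT.1 F hF).isFragment, hT.2.1, hT.2.2⟩, hcard⟩

/-- Lattice points in `[0,m)²`. -/
def latt (m : ℕ) : Finset (ℕ × ℕ) :=
  (Finset.range m ×ˢ Finset.range m).filter (fun p => 5 ∣ p.1 + 2 * p.2)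

def corners (m : ℕ) : Finset (ℕ × ℕ) :=
  {(0, 0), (0, m - 1), (m - 1, 0), (m - 1, m - 1)}

theorem row_card (m v : ℕ) :
    ((Finset.range m).filter (fun u => 5 ∣ u + 2 * v)).card = (m + 4 - (3 * v) % 5) / 5 := by
  induction m with
  | zero => simp; omega
  | succ m ih =>
    rw [Finset.range_add_one, Finset.filter_insert]
    split_ifs with h
    · rw [Finset.card_insert_of_notMem (by simp), ih]; omega
    · rw [ih]; omega

theorem latt_card (m : ℕ) :
    (latt m).card = ∑ v ∈ Finset.range m, (m + 4 - (3 * v) % 5) / 5 := by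
  unfold latt
  rw [Finset.card_filter, Finset.sum_product_right]
  refine Finset.sum_congr rfl fun v _ => ?_
  rw [← row_card, Finset.card_filter]

theorem block_sum (m j : ℕ) :
    ∑ v ∈ Finset.range (5 * j), (m + 4 - (3 * v) % 5) / 5 = j * m := by
  induction j with
  | zero => simp
  | succ j ih =>
    rw [show 5 * (j + 1) = 5 * j + 1 + 1 + 1 + 1 + 1 by ring]
    simp only [Finset.sum_range_succ, ih]
    rw [add_mul, one_mul]
    generalize j * m = z
    omega

theorem centers_card (n : ℕ) (hn : 2 ≤ n) :
    5 * (latt (n + 2) \ corners (n + 2)).card + kCorr n ≤ (n + 2) ^ 2 := by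
  obtain ⟨k, s, hs, hk⟩ : ∃ k s, s < 5 ∧ n + 2 = 5 * k + s :=
    ⟨(n + 2) / 5, (n + 2) % 5, by omega, by omega⟩
  have hL := latt_card (n + 2)
  have key : ∀ X : Finset (ℕ × ℕ), X ⊆ latt (n + 2) → X ⊆ corners (n + 2) →
      (latt (n + 2) \ corners (n + 2)).card + X.card ≤ (latt (n + 2)).card := by
    intro X h1 h2
    rw [← Finset.card_union_of_disjoint]
    · exact Finset.card_le_card (Finset.union_subset Finset.sdiff_subset h1)
    · exact Finset.sdiff_disjoint.mono_right h2
  have h1 := key {(0, 0)} (by simp [latt]) (by simp [corners])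
  rw [Finset.card_singleton] at h1
  rw [hk] at hL key h1 ⊢
  interval_cases s
  · have : kCorr n = 5 := by
      have hh : n % 5 = 3 := by omega
      simp [kCorr, hh]
    rw [this]
    rw [add_zero] at hL h1 ⊢
    rw [block_sum] at hL
    nlinarith
  · have : kCorr n = 16 := by
      have hh : n % 5 = 4 := by omega
      simp [kCorr, hh]
    rw [this]
    have h4 := key (corners (5 * k + 1)) (by
      intro p hp
      simp only [corners, Finset.mem_insert, Finset.mem_singleton] at hp
      simp only [latt, Finset.mem_filter, Finset.mem_product, Finset.mem_range]
      rcases hp with rfl | rfl | rfl | rfl <;> simp <;> omega) (Finset.Subset.refl _)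
    have h5 : (corners (5 * k + 1)).card = 4 := by
      have : 5 * k ≠ 0 := by omega
      unfold corners
      simp only [Nat.add_sub_cancel]
      rw [Finset.card_insert_of_notMem, Finset.card_insert_of_notMem,
        Finset.card_insert_of_notMem, Finset.card_singleton] <;> simp <;> omega
    simp only [Finset.sum_range_succ, block_sum] at hL
    have e : (5 * k + 1 + 4 - 3 * (5 * k) % 5) / 5 = k + 1 := by omega
    rw [e] at hL
    nlinarith
  · have : kCorr n = 4 := by
      have hh : n % 5 = 0 := by omega
      simp [kCorr, hh]
    rw [this]
    simp only [Finset.sum_range_succ, block_sum] at hL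
    have e : (5 * k + 2 + 4 - 3 * (5 * k) % 5) / 5 = k + 1 := by omega
    have e1 : (5 * k + 2 + 4 - 3 * (5 * k + 1) % 5) / 5 = k := by omega
    rw [e, e1] at hL
    nlinarith
  · have : kCorr n = 4 := by
      have hh : n % 5 = 1 := by omega
      simp [kCorr, hh]
    rw [this]
    simp only [Finset.sum_range_succ, block_sum] at hL
    have e : (5 * k + 3 + 4 - 3 * (5 * k) % 5) / 5 = k + 1 := by omega
    have e1 : (5 * k + 3 + 4 - 3 * (5 * k + 1) % 5) / 5 = k := by omega
    have e2 : (5 * k + 3 + 4 - 3 * (5 * k + 2) % 5) / 5 = k + 1 := by omega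
    rw [e, e1, e2] at hL
    nlinarith
  · have : kCorr n = 6 := by
      have hh : n % 5 = 2 := by omega
      simp [kCorr, hh]
    rw [this]
    simp only [Finset.sum_range_succ, block_sum] at hL
    have e : (5 * k + 4 + 4 - 3 * (5 * k) % 5) / 5 = k + 1 := by omega
    have e1 : (5 * k + 4 + 4 - 3 * (5 * k + 1) % 5) / 5 = k + 1 := by omega
    have e2 : (5 * k + 4 + 4 - 3 * (5 * k + 2) % 5) / 5 = k + 1 := by omega
    have e3 : (5 * k + 4 + 4 - 3 * (5 * k + 3) % 5) / 5 = k := by omega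
    rw [e, e1, e2, e3] at hL
    nlinarith

/-- Move a center of the extended board into the board. -/
def clampCell (n : ℕ) (p : ℕ × ℕ) : Cell :=
  (max 0 (min ((p.1 : ℤ) - 1) (n - 1)), max 0 (min ((p.2 : ℤ) - 1) (n - 1)))

theorem centers_cover (n : ℕ) (p : Cell) (hp : p ∈ Sq n) :
    ∃ c ∈ latt (n + 2) \ corners (n + 2), p ∈ Xpent (clampCell n c) := by
  obtain ⟨x, y⟩ := p
  obtain ⟨hx, hxn, hy, hyn⟩ := hp
  simp only at hx hxn hy hyn
  lift x to ℕ using hx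
  lift y to ℕ using hy
  have key : ∀ a b : ℕ, 5 ∣ a + 2 * b → ((a = x + 1 ∧ (b = y ∨ b = y + 1 ∨ b = y + 2)) ∨
      (b = y + 1 ∧ (a = x ∨ a = x + 2))) →
      ∃ c ∈ latt (n + 2) \ corners (n + 2), ((x : ℤ), (y : ℤ)) ∈ Xpent (clampCell n c) := by
    intro a b h5 hab
    refine ⟨(a, b), ?_, ?_⟩
    · simp only [latt, corners, Finset.mem_sdiff, Finset.mem_filter, Finset.mem_product,
        Finset.mem_range, Finset.mem_insert, Finset.mem_singleton, Prod.mk.injEq]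
      refine ⟨⟨⟨by omega, by omega⟩, h5⟩, by omega⟩
    · simp only [Xpent, clampCell, Set.mem_insert_iff, Set.mem_singleton_iff, Prod.mk.injEq]
      omega
  have hr : (x + 1 + 2 * (y + 1)) % 5 < 5 := Nat.mod_lt _ (by norm_num)
  by_cases h0 : (x + 1 + 2 * (y + 1)) % 5 = 0
  · exact key (x + 1) (y + 1) (by omega) (by omega)
  by_cases h1 : (x + 1 + 2 * (y + 1)) % 5 = 1
  · exact key x (y + 1) (by omega) (by omega)
  by_cases h2 : (x + 1 + 2 * (y + 1)) % 5 = 2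
  · exact key (x + 1) y (by omega) (by omega)
  by_cases h3 : (x + 1 + 2 * (y + 1)) % 5 = 3
  · exact key (x + 1) (y + 2) (by omega) (by omega)
  · exact key (x + 2) (y + 1) (by omega) (by omega)

theorem Sq_board (n : ℕ) (hn : 2 ≤ n) : ∀ p ∈ Sq n, ∃ q ∈ Sq n, Adj p q := by
  rintro ⟨x, y⟩ ⟨hx, hxn, hy, hyn⟩
  simp only at hx hxn hy hyn
  by_cases h : x = 0
  · refine ⟨(x + 1, y), ⟨?_, ?_, hy, hyn⟩, ?_⟩
    · simp only; omega
    · simp only; omega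
    · simp [Adj]
  · refine ⟨(x - 1, y), ⟨?_, ?_, hy, hyn⟩, ?_⟩
    · simp only; omega
    · simp only; omega
    · simp [Adj]

theorem upper_tiling (n : ℕ) (hn : 2 ≤ n) :
    ∃ T, IsFragmentTiling (Sq n) T ∧ 5 * T.card + kCorr n ≤ (n + 2) ^ 2 := by
  classical
  obtain ⟨T, hT, hc⟩ := exists_tiling (Sq_board n hn)
    ((latt (n + 2) \ corners (n + 2)).image (clampCell n))
    (by
      intro c hc
      obtain ⟨d, -, rfl⟩ := Finset.mem_image.1 hc
      simp only [Sq, clampCell, Set.mem_setOf_eq]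
      omega)
    (by
      intro p hp
      obtain ⟨c, hc, hpc⟩ := centers_cover n p hp
      exact ⟨_, Finset.mem_image_of_mem _ hc, hpc⟩)
  refine ⟨T, hT, ?_⟩
  have h1 := centers_card n hn
  have h2 := Finset.card_image_le (s := latt (n + 2) \ corners (n + 2)) (f := clampCell n)
  omega

theorem Sq_ncard (n : ℕ) : (Sq n).ncard = n * n := by
  have : Sq n = ↑(Finset.Ico (0 : ℤ) n ×ˢ Finset.Ico (0 : ℤ) n) := by
    ext p
    simp [Sq, and_assoc]
  rw [this, Set.ncard_coe_finset, Finset.card_product]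
  simp

theorem lower_tiling (n : ℕ) (T : Finset (Set Cell)) (hT : IsFragmentTiling (Sq n) T) :
    n * n ≤ 5 * T.card := by
  rw [← Sq_ncard, ← hT.2.2]
  refine (Finset.set_ncard_biUnion_le T (fun F => F)).trans ?_
  rw [mul_comm, ← smul_eq_mul]
  refine Finset.sum_le_card_nsmul _ _ _ fun F hF => ?_
  obtain ⟨⟨c, hc⟩, -⟩ := hT.1 F hF
  exact (Set.ncard_le_ncard hc (Xpent_finite c)).trans (Xpent_ncard c)

/-- For `n ≥ 2`, `n²/5 ≤ f(n) ≤ ((n+2)² − k(n))/5`, and the latter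
quantity is an integer. -/
theorem fNum_bounds (n : ℕ) (hn : 2 ≤ n) :
    (n : ℚ) ^ 2 / 5 ≤ (fNum (Sq n) : ℚ) ∧
    (fNum (Sq n) : ℚ) ≤ (((n : ℚ) + 2) ^ 2 - (kCorr n : ℚ)) / 5 ∧
    (5 : ℤ) ∣ (((n : ℤ) + 2) ^ 2 - (kCorr n : ℤ)) := by
  obtain ⟨T, hT, hc⟩ := upper_tiling n hn
  have hmem : T.card ∈ {k : ℕ | ∃ T : Finset (Set Cell), IsFragmentTiling (Sq n) T ∧ T.card = k} :=
    ⟨T, hT, rfl⟩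
  have hle : fNum (Sq n) ≤ T.card := Nat.sInf_le hmem
  obtain ⟨T₀, hT₀, hc₀⟩ := Nat.sInf_mem ⟨_, hmem⟩
  have hlow := lower_tiling n T₀ hT₀
  change T₀.card = fNum (Sq n) at hc₀
  rw [hc₀] at hlow
  refine ⟨?_, ?_, ?_⟩
  · rw [div_le_iff₀ (by norm_num)]
    have : ((n * n : ℕ) : ℚ) ≤ ((5 * fNum (Sq n) : ℕ) : ℚ) := by exact_mod_cast hlow
    push_cast at this
    linarith
  · rw [le_div_iff₀ (by norm_num)]
    have h2 : 5 * fNum (Sq n) + kCorr n ≤ (n + 2) ^ 2 := by omega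
    have : ((5 * fNum (Sq n) + kCorr n : ℕ) : ℚ) ≤ (((n + 2) ^ 2 : ℕ) : ℚ) := by exact_mod_cast h2
    push_cast at this
    linarith
  · obtain ⟨k, s, hs, hk⟩ : ∃ k s, s < 5 ∧ n = 5 * k + s :=
      ⟨n / 5, n % 5, by omega, by omega⟩
    have hm : n % 5 = s := by omega
    unfold kCorr
    rw [hm, hk]
    interval_cases s <;> push_cast
    · exact ⟨5 * k ^ 2 + 4 * k, by ring⟩
    · exact ⟨5 * k ^ 2 + 6 * k + 1, by ring⟩
    · exact ⟨5 * k ^ 2 + 8 * k + 2, by ring⟩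
    · exact ⟨5 * k ^ 2 + 10 * k + 4, by ring⟩
    · exact ⟨5 * k ^ 2 + 12 * k + 4, by ring⟩
end

section
/- For every n ≥ 1, the 2 × n board R_{2,n} satisfies f(R_{2,n}) = ⌊(n+2)/2⌋ and d(R_{2,n}) = 2n − ⌊(n+2)/2⌋. -/
/-- The `m × n` board `{0, …, m-1} × {0, …, n-1}`. -/
def Rect (m n : ℕ) : Set Cell := {p : Cell | 0 ≤ p.1 ∧ p.1 < m ∧ 0 ≤ p.2 ∧ p.2 < n}

/-- The `2 × n` board as a finset. -/
noncomputable def boardF (n : ℕ) : Finset Cell := Finset.Icc 0 1 ×ˢ Finset.Ico 0 (n : ℤ)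

theorem mem_boardF (n : ℕ) (p : Cell) :
    p ∈ boardF n ↔ (0 ≤ p.1 ∧ p.1 ≤ 1) ∧ (0 ≤ p.2 ∧ p.2 < n) := by
  simp [boardF]

theorem coe_boardF (n : ℕ) : (boardF n : Set Cell) = Rect 2 n := by
  ext p
  simp only [Finset.mem_coe, mem_boardF, Rect, Set.mem_ofPred_eq]
  push_cast
  omega

theorem card_boardF (n : ℕ) : (boardF n).card = 2 * n := by
  simp [boardF]

theorem adj_cases {p q : Cell} (h : Adj p q) :
    p = (q.1 + 1, q.2) ∨ p = (q.1 - 1, q.2) ∨ p = (q.1, q.2 + 1) ∨ p = (q.1, q.2 - 1) := by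
  obtain ⟨a, b⟩ := p
  obtain ⟨c, d⟩ := q
  simp only [Adj, Prod.mk.injEq] at *
  have h1 : 0 ≤ |a - c| := abs_nonneg _
  rcases abs_cases (a - c) with h2 | h2 <;> rcases abs_cases (b - d) with h3 | h3 <;> omega

theorem adj_ne {p q : Cell} (h : Adj p q) : p ≠ q := by
  rintro rfl
  simp [Adj] at h

theorem adj_mem_Xpent {p q : Cell} (h : Adj p q) : p ∈ Xpent q := by
  simp only [Xpent, Set.mem_insert_iff, Set.mem_singleton_iff]
  right; exact adj_cases h

/-- The X-pentomino as a finset. -/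
def xF (c : Cell) : Finset Cell :=
  {c, (c.1 + 1, c.2), (c.1 - 1, c.2), (c.1, c.2 + 1), (c.1, c.2 - 1)}

theorem mem_xF (c p : Cell) : p ∈ xF c ↔ p ∈ Xpent c := by
  simp [xF, Xpent]

theorem mem_xF' (c p : Cell) : p ∈ xF c ↔ (p.1 = c.1 ∧ p.2 = c.2) ∨
    (p.1 = c.1 + 1 ∧ p.2 = c.2) ∨ (p.1 = c.1 - 1 ∧ p.2 = c.2) ∨
    (p.1 = c.1 ∧ p.2 = c.2 + 1) ∨ (p.1 = c.1 ∧ p.2 = c.2 - 1) := by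
  simp [xF, Prod.ext_iff]

theorem xF_card_le (n : ℕ) (c : Cell) : (xF c ∩ boardF n).card ≤ 4 := by
  obtain ⟨a, b⟩ := c
  have hs : xF (a, b) ∩ boardF n ⊆ {((0 : ℤ), b), (1, b), (a, b + 1), (a, b - 1)} := by
    rintro ⟨x, y⟩ h
    simp only [Finset.mem_inter, mem_xF', mem_boardF] at h
    simp only [Finset.mem_insert, Finset.mem_singleton, Prod.mk.injEq]
    omega
  exact (Finset.card_le_card hs).trans Finset.card_le_four

theorem cover_sub (n : ℕ) (C S : Finset Cell) (hS : S ⊆ C)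
    (hC : ∀ p ∈ boardF n, ∃ c ∈ C, p ∈ xF c)
    (U : Finset Cell) (hU : ∀ s ∈ S, xF s ∩ boardF n ⊆ U)
    (hc : U.card + 1 ≤ 4 * S.card) : 2 * n + 1 ≤ 4 * C.card := by
  have h1 : boardF n ⊆ U ∪ (C \ S).biUnion (fun c => xF c ∩ boardF n) := by
    intro p hp
    obtain ⟨c, hc, hpc⟩ := hC p hp
    by_cases hs : c ∈ S
    · exact Finset.mem_union_left _ (hU c hs (Finset.mem_inter.2 ⟨hpc, hp⟩))
    · refine Finset.mem_union_right _ (Finset.mem_biUnion.2 ⟨c, ?_, ?_⟩)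
      · exact Finset.mem_sdiff.2 ⟨hc, hs⟩
      · exact Finset.mem_inter.2 ⟨hpc, hp⟩
  have h2 := (Finset.card_le_card h1).trans (Finset.card_union_le _ _)
  have h3 := Finset.card_biUnion_le_card_mul (C \ S) (fun c => xF c ∩ boardF n) 4
    (fun c _ => xF_card_le n c)
  rw [card_boardF] at h2
  have h4 := Finset.card_sdiff_add_card_eq_card hS
  omega

/-- Any covering of the `2 × n` board by `k` X-pentominoes has `n + 1 ≤ 2 k`. -/
theorem cover_bound (n : ℕ) (hn : 1 ≤ n) (C : Finset Cell)
    (hC : ∀ p ∈ boardF n, ∃ c ∈ C, p ∈ xF c) : n + 1 ≤ 2 * C.card := by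
  suffices h : 2 * n + 1 ≤ 4 * C.card by omega
  by_cases hcase : ∃ c ∈ C, c.2 ≤ 0 ∧ (∃ p ∈ boardF n, p.2 = 0 ∧ p ∈ xF c)
  · obtain ⟨c, hc, hc2, p, hp, hp0, hpc⟩ := hcase
    refine cover_sub n C {c} (by simpa using hc) hC (xF c ∩ boardF n) (by simp) ?_
    have hs : xF c ∩ boardF n ⊆ {((0 : ℤ), (0 : ℤ)), (1, 0), (c.1, 1)} := by
      rintro ⟨x, y⟩ h
      simp only [Finset.mem_inter, mem_xF', mem_boardF] at h hpc
      simp only [Finset.mem_insert, Finset.mem_singleton, Prod.mk.injEq]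
      omega
    have := (Finset.card_le_card hs).trans Finset.card_le_three
    simp only [Finset.card_singleton]
    omega
  · push Not at hcase
    have key : ∀ r : ℤ, 0 ≤ r → r ≤ 1 → (r, (1 : ℤ)) ∈ C := by
      intro r h0 h1
      have hb : (r, (0 : ℤ)) ∈ boardF n := by
        simp only [mem_boardF]; omega
      obtain ⟨⟨a, b⟩, hc, hpc⟩ := hC _ hb
      have h2 : ¬ b ≤ 0 := fun h => hcase _ hc h _ hb rfl hpc
      simp only [mem_xF'] at hpc
      have ha : a = r := by omega
      have hb1 : b = 1 := by omega
      subst ha hb1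
      exact hc
    have k0 := key 0 (by norm_num) (by norm_num)
    have k1 := key 1 (by norm_num) (by norm_num)
    refine cover_sub n C {((0 : ℤ), (1 : ℤ)), (1, 1)} ?_ hC
      {((0 : ℤ), (0 : ℤ)), (1, 0), (0, 1), (1, 1), (0, 2), (1, 2)} ?_ ?_
    · intro p hp
      simp only [Finset.mem_insert, Finset.mem_singleton] at hp
      rcases hp with rfl | rfl <;> assumption
    · intro s hs
      rintro ⟨x, y⟩ h
      simp only [Finset.mem_insert, Finset.mem_singleton] at hs
      simp only [Finset.mem_inter, mem_xF', mem_boardF] at h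
      simp only [Finset.mem_insert, Finset.mem_singleton, Prod.mk.injEq]
      rcases hs with rfl | rfl <;> simp only at h <;> omega
    · decide

theorem tiling_bound (n : ℕ) (hn : 1 ≤ n) (T : Finset (Set Cell))
    (hT : IsFragmentTiling (Rect 2 n) T) : n + 1 ≤ 2 * T.card := by
  classical
  obtain ⟨hF, -, hU⟩ := hT
  choose! c hc using fun F hFT => (hF F hFT).1
  have := cover_bound n hn (T.image c) (by
    intro p hp
    have hp' : p ∈ Rect 2 n := by rw [← coe_boardF]; exact hp
    rw [← hU] at hp'
    simp only [Set.mem_iUnion] at hp'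
    obtain ⟨F, hFT, hpF⟩ := hp'
    exact ⟨c F, Finset.mem_image_of_mem _ hFT, (mem_xF _ _).2 (hc F hFT hpF)⟩)
  have h2 : (T.image c).card ≤ T.card := Finset.card_image_le
  omega

theorem saturated_bound (n : ℕ) (hn : 1 ≤ n) (D : Finset (Finset Cell))
    (hD : IsSaturatedCovering (Rect 2 n) D) : 2 * D.card + (n + 1) ≤ 4 * n := by
  classical
  obtain ⟨⟨hdom, hU⟩, hsat⟩ := hD
  have hpriv : ∀ e ∈ D, ∃ v w : Cell, v ∈ boardF n ∧ w ∈ boardF n ∧ Adj v w ∧ e = {v, w} ∧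
      ∀ e' ∈ D, v ∈ e' → e' = e := by
    intro e he
    obtain ⟨v, hvB, hv⟩ := Set.exists_of_ssubset (hsat e he)
    have huniq : ∀ e' ∈ D, v ∈ e' → e' = e := by
      intro e' he' hve'
      by_contra hne
      apply hv
      simp only [Set.mem_iUnion]
      exact ⟨e', Finset.mem_erase.2 ⟨hne, he'⟩, hve'⟩
    have hve : v ∈ e := by
      rw [← hU] at hvB
      simp only [Set.mem_iUnion] at hvB
      obtain ⟨e', he', hve'⟩ := hvB
      have := huniq e' he' hve'
      subst this
      exact hve'
    obtain ⟨p, q, hp, hq, hpq, rfl⟩ := hdom e he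
    rw [← coe_boardF] at hp hq
    simp only [Finset.mem_insert, Finset.mem_singleton] at hve
    rcases hve with rfl | rfl
    · exact ⟨v, q, hp, hq, hpq, rfl, huniq⟩
    · exact ⟨v, p, hq, hp, adj_symm hpq, Finset.pair_comm _ _, huniq⟩
  choose! v w hv hw hvw he huniq using hpriv
  have hmemv : ∀ e ∈ D, v e ∈ e := by
    intro e h
    have h2 := he e h
    have : v e ∈ ({v e, w e} : Finset Cell) := by simp
    rwa [← h2] at this
  have hmemw : ∀ e ∈ D, w e ∈ e := by
    intro e h
    have h2 := he e h
    have : w e ∈ ({v e, w e} : Finset Cell) := by simp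
    rwa [← h2] at this
  have hinj : Set.InjOn v D := by
    intro e h e' h' heq
    have := hmemv e h
    rw [heq] at this
    exact huniq e' h' e h this
  have hcard : (D.image v).card = D.card := Finset.card_image_of_injOn hinj
  have hsub : D.image v ⊆ boardF n := by
    intro p hp
    obtain ⟨e, h, rfl⟩ := Finset.mem_image.1 hp
    exact hv e h
  have hcov := cover_bound n hn (boardF n \ D.image v) (by
    intro p hp
    by_cases hpi : p ∈ D.image v
    · obtain ⟨e, h, rfl⟩ := Finset.mem_image.1 hpi
      refine ⟨w e, ?_, (mem_xF _ _).2 (adj_mem_Xpent (hvw e h))⟩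
      refine Finset.mem_sdiff.2 ⟨hw e h, ?_⟩
      intro hwi
      obtain ⟨e', h', heq⟩ := Finset.mem_image.1 hwi
      have h1 := hmemw e h
      rw [← heq] at h1
      have h2 := huniq e' h' e h h1
      subst h2
      exact adj_ne (hvw e h) heq
    · exact ⟨p, Finset.mem_sdiff.2 ⟨hp, hpi⟩, by simp [xF]⟩)
  have h4 := Finset.card_sdiff_add_card_eq_card hsub
  rw [card_boardF] at h4
  omega

/-- A star partition of `B` given by its centre map. -/
structure StarMap (B : Finset Cell) (g : Cell → Cell) : Prop where
  maps : ∀ b ∈ B, g b ∈ B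
  idem : ∀ b ∈ B, g (g b) = g b
  adj : ∀ b ∈ B, g b ≠ b → Adj b (g b)
  leaf : ∀ b ∈ B, g b = b → ∃ b' ∈ B, b' ≠ b ∧ g b' = b

theorem StarMap.tiling {B : Finset Cell} {g : Cell → Cell} (h : StarMap B g) :
    ∃ T : Finset (Set Cell), IsFragmentTiling (B : Set Cell) T ∧
      T.card ≤ (B.filter (fun b => g b = b)).card := by
  classical
  refine ⟨(B.filter (fun b => g b = b)).image (fun c => {b : Cell | b ∈ B ∧ g b = c}),
    ⟨?_, ?_, ?_⟩, Finset.card_image_le⟩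
  · intro F hF
    obtain ⟨c, hc, rfl⟩ := Finset.mem_image.1 hF
    obtain ⟨hcB, hcc⟩ := Finset.mem_filter.1 hc
    refine ⟨⟨c, ?_⟩, ?_, ?_⟩
    · rintro b ⟨hb, rfl⟩
      by_cases hbb : g b = b
      · rw [hbb]; simp [Xpent]
      · exact adj_mem_Xpent (h.adj b hb hbb)
    · obtain ⟨b', hb', hne, hg⟩ := h.leaf c hcB hcc
      have hfin : {b : Cell | b ∈ B ∧ g b = c}.Finite :=
        B.finite_toSet.subset (fun b hb => hb.1)
      have : 1 < {b : Cell | b ∈ B ∧ g b = c}.ncard :=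
        (Set.one_lt_ncard hfin).2 ⟨b', ⟨hb', hg⟩, c, ⟨hcB, hcc⟩, hne⟩
      exact this
    · intro p hp q hq
      have hp1 : Relation.ReflTransGen (fun a b => a ∈ {b : Cell | b ∈ B ∧ g b = c} ∧
          b ∈ {b : Cell | b ∈ B ∧ g b = c} ∧ Adj a b) p c := by
        by_cases hpc : p = c
        · rw [hpc]
        · refine Relation.ReflTransGen.single ⟨hp, ⟨hcB, hcc⟩, ?_⟩
          have := h.adj p hp.1 (by rw [hp.2]; exact fun h => hpc h.symm)
          rwa [hp.2] at this
      refine hp1.trans ?_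
      by_cases hqc : q = c
      · rw [hqc]
      · refine Relation.ReflTransGen.single ⟨⟨hcB, hcc⟩, hq, ?_⟩
        have := h.adj q hq.1 (by rw [hq.2]; exact fun h => hqc h.symm)
        rw [hq.2] at this
        exact adj_symm this
  · intro F hF G hG hne
    obtain ⟨c, hc, rfl⟩ := Finset.mem_image.1 hF
    obtain ⟨d, hd, rfl⟩ := Finset.mem_image.1 hG
    rw [Set.disjoint_left]
    rintro b ⟨_, h1⟩ ⟨_, h2⟩
    apply hne
    rw [← h1, ← h2]
  · ext b
    simp only [Set.mem_iUnion, Finset.mem_coe]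
    constructor
    · rintro ⟨F, hF, hb⟩
      obtain ⟨c, hc, rfl⟩ := Finset.mem_image.1 hF
      exact hb.1
    · intro hb
      exact ⟨_, Finset.mem_image_of_mem _
        (Finset.mem_filter.2 ⟨h.maps b hb, h.idem b hb⟩), hb, rfl⟩

theorem StarMap.covering {B : Finset Cell} {g : Cell → Cell} (h : StarMap B g) :
    ∃ D : Finset (Finset Cell), IsSaturatedCovering (B : Set Cell) D ∧
      D.card + (B.filter (fun b => g b = b)).card = B.card := by
  classical
  have hinj : Set.InjOn (fun b => ({b, g b} : Finset Cell))
      (B.filter (fun b => ¬ g b = b)) := by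
    intro b hb b' hb' heq
    obtain ⟨hbB, hbb⟩ := Finset.mem_filter.1 (Finset.mem_coe.1 hb)
    obtain ⟨hbB', hbb'⟩ := Finset.mem_filter.1 (Finset.mem_coe.1 hb')
    have h1 : b ∈ ({b', g b'} : Finset Cell) := by
      have : b ∈ ({b, g b} : Finset Cell) := by simp
      simp only at heq
      rwa [heq] at this
    simp only [Finset.mem_insert, Finset.mem_singleton] at h1
    rcases h1 with h1 | h1
    · exact h1
    · exact absurd (by rw [h1]; exact h.idem b' hbB') hbb
  refine ⟨(B.filter (fun b => ¬ g b = b)).image (fun b => {b, g b}), ⟨⟨?_, ?_⟩, ?_⟩, ?_⟩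
  · intro e he
    obtain ⟨b, hb, rfl⟩ := Finset.mem_image.1 he
    obtain ⟨hbB, hbb⟩ := Finset.mem_filter.1 hb
    exact ⟨b, g b, hbB, h.maps b hbB, h.adj b hbB hbb, rfl⟩
  · ext p
    simp only [Set.mem_iUnion, Finset.mem_coe]
    constructor
    · rintro ⟨e, he, hp⟩
      obtain ⟨b, hb, rfl⟩ := Finset.mem_image.1 he
      obtain ⟨hbB, hbb⟩ := Finset.mem_filter.1 hb
      simp only [Finset.mem_insert, Finset.mem_singleton] at hp
      rcases hp with rfl | rfl
      · exact hbB
      · exact h.maps b hbB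
    · intro hp
      by_cases hpp : g p = p
      · obtain ⟨b', hb', hne, hg⟩ := h.leaf p hp hpp
        refine ⟨_, Finset.mem_image_of_mem _ (Finset.mem_filter.2 ⟨hb', ?_⟩), ?_⟩
        · rw [hg]; exact fun h => hne h.symm
        · simp [hg]
      · exact ⟨_, Finset.mem_image_of_mem _ (Finset.mem_filter.2 ⟨hp, hpp⟩), by simp⟩
  · intro e he
    obtain ⟨b, hb, rfl⟩ := Finset.mem_image.1 he
    obtain ⟨hbB, hbb⟩ := Finset.mem_filter.1 hb
    rw [Set.ssubset_iff_of_subset]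
    · refine ⟨b, hbB, ?_⟩
      simp only [Set.mem_iUnion, Finset.mem_coe]
      rintro ⟨e', he', hbe⟩
      obtain ⟨hne, he'⟩ := Finset.mem_erase.1 he'
      obtain ⟨b', hb', rfl⟩ := Finset.mem_image.1 he'
      obtain ⟨hbB', hbb'⟩ := Finset.mem_filter.1 hb'
      simp only [Finset.mem_insert, Finset.mem_singleton] at hbe
      rcases hbe with rfl | hbe
      · exact hne rfl
      · exact hbb (by rw [hbe]; exact h.idem b' hbB')
    · intro p
      simp only [Set.mem_iUnion, Finset.mem_coe]
      rintro ⟨e', he', hp⟩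
      obtain ⟨b', hb', rfl⟩ := Finset.mem_image.1 (Finset.mem_of_mem_erase he')
      obtain ⟨hbB', hbb'⟩ := Finset.mem_filter.1 hb'
      simp only [Finset.mem_insert, Finset.mem_singleton] at hp
      rcases hp with rfl | rfl
      · exact hbB'
      · exact h.maps b' hbB'
  · rw [Finset.card_image_of_injOn hinj, add_comm]
    exact Finset.card_filter_add_card_filter_not _

/-- The centre map of an optimal star partition of the `2 × n` board. -/
def ctr (n : ℕ) (p : Cell) : Cell :=
  if p.2 % 2 = 0 ∨ p.2 = n - 1 then ((p.2 + 1) / 2 % 2, p.2)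
  else if p.1 = p.2 / 2 % 2 then (p.1, p.2 - 1) else (p.1, p.2 + 1)

theorem ctr_cases (n : ℕ) (x y : ℤ) :
    ((y % 2 = 0 ∨ y = n - 1) ∧ ctr n (x, y) = ((y + 1) / 2 % 2, y)) ∨
    (¬ (y % 2 = 0 ∨ y = n - 1) ∧ x = y / 2 % 2 ∧ ctr n (x, y) = (x, y - 1)) ∨
    (¬ (y % 2 = 0 ∨ y = n - 1) ∧ x ≠ y / 2 % 2 ∧ ctr n (x, y) = (x, y + 1)) := by
  unfold ctr
  simp only
  split_ifs with h1 h2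
  · exact Or.inl ⟨h1, rfl⟩
  · exact Or.inr (Or.inl ⟨h1, h2, rfl⟩)
  · exact Or.inr (Or.inr ⟨h1, h2, rfl⟩)

theorem ctr_fix (n : ℕ) (x y : ℤ) :
    ctr n (x, y) = (x, y) ↔ (y % 2 = 0 ∨ y = n - 1) ∧ x = (y + 1) / 2 % 2 := by
  rcases ctr_cases n x y with ⟨h1, h⟩ | ⟨h1, h2, h⟩ | ⟨h1, h2, h⟩ <;> rw [h] <;>
    simp only [Prod.mk.injEq]
  · exact ⟨fun h5 => ⟨h1, h5.1.symm⟩, fun h5 => ⟨h5.2.symm, trivial⟩⟩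
  · constructor <;> intro h5 <;> omega
  · constructor <;> intro h5 <;> omega

theorem ctr_star (n : ℕ) : StarMap (boardF n) (ctr n) where
  maps := by
    rintro ⟨x, y⟩ hb
    simp only [mem_boardF] at hb
    rcases ctr_cases n x y with ⟨h1, h⟩ | ⟨h1, h2, h⟩ | ⟨h1, h2, h⟩ <;> rw [h] <;>
      simp only [mem_boardF] <;> omega
  idem := by
    rintro ⟨x, y⟩ hb
    simp only [mem_boardF] at hb
    rcases ctr_cases n x y with ⟨h1, h⟩ | ⟨h1, h2, h⟩ | ⟨h1, h2, h⟩ <;> rw [h, ctr_fix] <;>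
      omega
  adj := by
    rintro ⟨x, y⟩ hb hne
    simp only [mem_boardF] at hb
    rw [Ne, ctr_fix] at hne
    rcases ctr_cases n x y with ⟨h1, h⟩ | ⟨h1, h2, h⟩ | ⟨h1, h2, h⟩ <;> rw [h] <;>
      simp only [Adj]
    · rcases abs_cases (x - (y + 1) / 2 % 2) with h3 | h3 <;> simp only [sub_self, abs_zero] <;>
        omega
    · simp
    · simp
  leaf := by
    rintro ⟨x, y⟩ hb hfix
    simp only [mem_boardF] at hb
    rw [ctr_fix] at hfix
    refine ⟨(1 - x, y), ?_, ?_, ?_⟩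
    · simp only [mem_boardF]; omega
    · simp only [Ne, Prod.mk.injEq]; omega
    · rcases ctr_cases n (1 - x) y with ⟨h1, h⟩ | ⟨h1, h2, h⟩ | ⟨h1, h2, h⟩
      · rw [h, hfix.2]
      · exact absurd hfix.1 h1
      · exact absurd hfix.1 h1

theorem ctr_count (n : ℕ) :
    ((boardF n).filter (fun b => ctr n b = b)).card ≤ n / 2 + 1 := by
  have := Finset.card_le_card_of_injOn (s := (boardF n).filter (fun b => ctr n b = b))
    (t := Finset.range (n / 2 + 1)) (fun p => ((p.2 + 1) / 2).toNat) ?_ ?_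
  · simpa using this
  · rintro ⟨x, y⟩ hb
    obtain ⟨hb, hf⟩ := Finset.mem_filter.1 (Finset.mem_coe.1 hb)
    simp only [mem_boardF] at hb
    simp only [Finset.coe_range, Set.mem_Iio]
    omega
  · rintro ⟨x, y⟩ hb ⟨x', y'⟩ hb' heq
    obtain ⟨hb, hf⟩ := Finset.mem_filter.1 (Finset.mem_coe.1 hb)
    obtain ⟨hb', hf'⟩ := Finset.mem_filter.1 (Finset.mem_coe.1 hb')
    simp only [mem_boardF] at hb hb'
    rw [ctr_fix] at hf hf'
    simp only at heq
    simp only [Prod.mk.injEq]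
    omega

/-- For `n ≥ 1`, `f(R₂ₙ) = ⌊(n+2)/2⌋` and `d(R₂ₙ) = 2n − ⌊(n+2)/2⌋`. -/
theorem fNum_dNum_two_by_n (n : ℕ) (hn : 1 ≤ n) :
    (fNum (Rect 2 n) : ℤ) = ⌊((n : ℚ) + 2) / 2⌋ ∧
    (dNum (Rect 2 n) : ℤ) = 2 * (n : ℤ) - ⌊((n : ℚ) + 2) / 2⌋ := by
  have hfl : ⌊((n : ℚ) + 2) / 2⌋ = ((n : ℤ) + 2) / 2 := by
    have := Rat.floor_intCast_div_natCast ((n : ℤ) + 2) 2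
    push_cast at this
    exact this
  rw [hfl]
  obtain ⟨T, hT, hTc⟩ := (ctr_star n).tiling
  obtain ⟨D, hD, hDc⟩ := (ctr_star n).covering
  have hk := ctr_count n
  rw [card_boardF] at hDc
  rw [coe_boardF] at hT hD
  constructor
  · have h1 : fNum (Rect 2 n) ≤ T.card := Nat.sInf_le ⟨T, hT, rfl⟩
    have hne : {k : ℕ | ∃ T : Finset (Set Cell),
        IsFragmentTiling (Rect 2 n) T ∧ T.card = k}.Nonempty := ⟨_, T, hT, rfl⟩
    obtain ⟨T', hT', hc'⟩ := Nat.sInf_mem hne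
    have h2 := tiling_bound n hn T' hT'
    have h3 : fNum (Rect 2 n) = T'.card := hc'.symm
    omega
  · have hbd : BddAbove {k : ℕ | ∃ D : Finset (Finset Cell),
        IsSaturatedCovering (Rect 2 n) D ∧ D.card = k} := by
      refine ⟨2 * n, ?_⟩
      rintro k ⟨D', hD', rfl⟩
      have := saturated_bound n hn D' hD'
      omega
    have hne : {k : ℕ | ∃ D : Finset (Finset Cell),
        IsSaturatedCovering (Rect 2 n) D ∧ D.card = k}.Nonempty := ⟨_, D, hD, rfl⟩
    have h1 : D.card ≤ dNum (Rect 2 n) := le_csSup hbd ⟨D, hD, rfl⟩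
    obtain ⟨D', hD', hc'⟩ := Nat.sSup_mem hne hbd
    have h2 := saturated_bound n hn D' hD'
    have h3 : dNum (Rect 2 n) = D'.card := hc'.symm
    omega
end

section
/- For every n ≥ 1, the 3 × n board R_{3,n} satisfies f(R_{3,n}) = ⌊(3n+4)/4⌋ and d(R_{3,n}) = 3n − ⌊(3n+4)/4⌋. -/
/-! ### The board as a finset -/

/-- The 3 × n board as a finset. -/
noncomputable def rectF (n : ℕ) : Finset Cell := Finset.Ico (0 : ℤ) 3 ×ˢ Finset.Ico (0 : ℤ) n

theorem mem_rectF (n : ℕ) (p : Cell) : p ∈ rectF n ↔ p ∈ Rect 3 n := by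
  simp [rectF, Rect, and_assoc]

theorem card_rectF (n : ℕ) : (rectF n).card = 3 * n := by
  simp [rectF, Finset.card_product]

/-- Explicit form of adjacency. -/
theorem adj_iff (p q : Cell) : Adj p q ↔
    (p.1 = q.1 ∧ (p.2 = q.2 + 1 ∨ q.2 = p.2 + 1)) ∨
    (p.2 = q.2 ∧ (p.1 = q.1 + 1 ∨ q.1 = p.1 + 1)) := by
  unfold Adj
  rcases abs_cases (p.1 - q.1) with h | h <;> rcases abs_cases (p.2 - q.2) with h' | h' <;> omega

theorem mem_Xpent (c p : Cell) : p ∈ Xpent c ↔ p = c ∨ Adj p c := by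
  obtain ⟨a, b⟩ := p
  obtain ⟨x, y⟩ := c
  simp only [Xpent, adj_iff, Set.mem_insert_iff, Set.mem_singleton_iff, Prod.mk.injEq]
  omega

/-! ### Lower bound for dominating sets -/

/-- Potential table (shortest path distances in the column transfer graph). -/
def tbl : List ℕ :=
  [0, 4, 4, 7, 4, 6, 7, 9, 2, 6, 6, 10, 5, 9, 9, 13, 1, 5, 5, 9, 5, 9, 9, 13, 4, 8, 8, 12, 8, 12,
   12, 16, 2, 5, 6, 9, 6, 9, 10, 13, 3, 7, 7, 11, 7, 11, 11, 15, 4, 8, 8, 12, 8, 12, 12, 16,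
   6, 10, 10, 14, 10, 14, 14, 18]

def psi (a b c a1 b1 c1 : Bool) : ℕ :=
  tbl.getD (8 * (a.toNat + 2 * b.toNat + 4 * c.toNat) + (a1.toNat + 2 * b1.toNat + 4 * c1.toNat)) 0

theorem psi_init : ∀ a b c : Bool,
    psi false false false a b c ≤ 4 * (a.toNat + b.toNat + c.toNat) := by decide

theorem psi_step : ∀ a b c a1 b1 c1 a2 b2 c2 : Bool,
    (a || a1 || a2 || b1) = true → (b || b1 || b2 || a1 || c1) = true →
    (c || c1 || c2 || b1) = true →
    psi a1 b1 c1 a2 b2 c2 + 3 ≤ psi a b c a1 b1 c1 + 4 * (a2.toNat + b2.toNat + c2.toNat) := by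
  decide

theorem psi_final : ∀ a b c a1 b1 c1 : Bool,
    (a || a1 || b1) = true → (b || b1 || a1 || c1) = true → (c || c1 || b1) = true →
    4 ≤ psi a b c a1 b1 c1 := by
  decide

/-- `C` is a dominating set of the 3 × n board. -/
def Dominates (n : ℕ) (C : Finset Cell) : Prop :=
  (∀ c ∈ C, c ∈ Rect 3 n) ∧ ∀ p ∈ Rect 3 n, ∃ c ∈ C, p = c ∨ Adj p c

theorem dom_lower (n : ℕ) (hn : 1 ≤ n) (C : Finset Cell) (hC : Dominates n C) :
    3 * n + 1 ≤ 4 * C.card := by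
  obtain ⟨hsub, hdom⟩ := hC
  let x : ℤ → ℤ → Bool := fun i j => decide ((i, j) ∈ C)
  have hx : ∀ i j, x i j = true ↔ (i, j) ∈ C := by intro i j; simp [x]
  have hout : ∀ i j, (j < 0 ∨ (n : ℤ) ≤ j) → x i j = false := by
    intro i j h
    rw [← Bool.not_eq_true, hx]
    intro hc
    have := hsub _ hc
    simp only [Rect, Set.mem_ofPred_eq] at this
    omega
  have houti : ∀ i j, (i < 0 ∨ 3 ≤ i) → (i, j) ∉ C := by
    intro i j h hc
    have := hsub _ hc
    simp only [Rect, Set.mem_ofPred_eq] at this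
    omega
  have hcell : ∀ i j : ℤ, 0 ≤ i → i < 3 → 0 ≤ j → j < n →
      (i, j) ∈ C ∨ (i, j - 1) ∈ C ∨ (i, j + 1) ∈ C ∨ (i - 1, j) ∈ C ∨ (i + 1, j) ∈ C := by
    intro i j h0 h1 h2 h3
    obtain ⟨⟨c, d⟩, hc, h⟩ := hdom (i, j) ⟨h0, by simpa using h1, h2, h3⟩
    rw [adj_iff] at h
    simp only [Prod.mk.injEq] at h
    rcases h with ⟨rfl, rfl⟩ | ⟨rfl, h | h⟩ | ⟨rfl, h | h⟩
    · exact Or.inl hc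
    · obtain rfl : d = j - 1 := by omega
      tauto
    · subst h; tauto
    · obtain rfl : c = i - 1 := by omega
      tauto
    · subst h; tauto
  have hv : ∀ j : ℤ, 0 ≤ j → j < n →
      (x 0 (j-1) || x 0 j || x 0 (j+1) || x 1 j) = true ∧
      (x 1 (j-1) || x 1 j || x 1 (j+1) || x 0 j || x 2 j) = true ∧
      (x 2 (j-1) || x 2 j || x 2 (j+1) || x 1 j) = true := by
    intro j h0 h1
    have e0 := hcell 0 j (by norm_num) (by norm_num) h0 h1
    have e1 := hcell 1 j (by norm_num) (by norm_num) h0 h1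
    have e2 := hcell 2 j (by norm_num) (by norm_num) h0 h1
    have o0 := houti (0 - 1) j (by norm_num)
    have o2 := houti (2 + 1) j (by norm_num)
    norm_num at e0 e1 e2 o0 o2
    simp only [Bool.or_eq_true, hx]
    refine ⟨?_, ?_, ?_⟩
    · rcases e0 with h | h | h | h | h
      all_goals first
        | exact absurd h o0
        | simp [h]
    · rcases e1 with h | h | h | h | h <;> simp [h]
    · rcases e2 with h | h | h | h | h
      all_goals first
        | exact absurd h o2
        | simp [h]
  let w : ℕ → ℕ := fun j => (x 0 j).toNat + (x 1 j).toNat + (x 2 j).toNat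
  have hcard : ∑ j ∈ Finset.range n, w j ≤ C.card := by
    let S := ((Finset.range n) ×ˢ (Finset.range 3)).filter
      (fun q : ℕ × ℕ => ((q.2 : ℤ), (q.1 : ℤ)) ∈ C)
    have h1 : S.card = ∑ j ∈ Finset.range n, w j := by
      simp only [S, Finset.card_filter, Finset.sum_product]
      refine Finset.sum_congr rfl fun j _ => ?_
      simp only [Finset.sum_range_succ, Finset.sum_range_zero, w, x, Bool.toNat]
      simp [Bool.cond_decide]
    rw [← h1]
    apply Finset.card_le_card_of_injOn (fun q : ℕ × ℕ => ((q.2 : ℤ), (q.1 : ℤ)))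
    · intro q hq
      exact (Finset.mem_filter.1 hq).2
    · rintro ⟨a, b⟩ _ ⟨c, d⟩ _ h
      simp only [Prod.mk.injEq, Nat.cast_inj] at h
      simp [h.1, h.2]
  have key : ∀ m : ℕ, m < n →
      psi (x 0 ((m:ℤ)-1)) (x 1 ((m:ℤ)-1)) (x 2 ((m:ℤ)-1)) (x 0 m) (x 1 m) (x 2 m) + 3 * m
        ≤ 4 * ∑ j ∈ Finset.range (m+1), w j := by
    intro m
    induction m with
    | zero =>
      intro _
      have := psi_init (x 0 0) (x 1 0) (x 2 0)
      simp only [Nat.cast_zero, hout _ (0 - 1) (by norm_num)]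
      simpa [w] using this
    | succ k ih =>
      intro hk
      have h1 := ih (by omega)
      obtain ⟨v0, v1, v2⟩ := hv k (by omega) (by omega)
      have h2 := psi_step _ _ _ _ _ _ _ _ _ v0 v1 v2
      rw [Finset.sum_range_succ]
      have e : (((k + 1 : ℕ) : ℤ) - 1) = k := by push_cast; ring
      have e' : ((k + 1 : ℕ) : ℤ) = (k : ℤ) + 1 := by push_cast; ring
      rw [e]
      simp only [w, e'] at h1 h2 ⊢
      omega
  obtain ⟨k, rfl⟩ : ∃ k, n = k + 1 := ⟨n - 1, by omega⟩
  have h1 := key k (by omega)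
  obtain ⟨v0, v1, v2⟩ := hv k (by omega) (by omega)
  simp only [hout _ ((k : ℤ) + 1) (by right; push_cast; omega), Bool.or_false] at v0 v1 v2
  have h2 := psi_final _ _ _ _ _ _ v0 v1 v2
  omega

/-! ### The explicit star decomposition -/

/-- Assigns each cell of the 3 × n board the centre of its star. -/
def gmap (n : ℕ) (p : Cell) : Cell :=
  if p.2 % 4 = 0 then (1, p.2)
  else if p.2 % 4 = 2 then (if p.1 = 2 then (2, p.2) else (0, p.2))
  else if p.2 = n - 1 then (1, p.2)
  else if p.2 % 4 = 1 then (if p.1 = 1 then (1, p.2 - 1) else (p.1, p.2 + 1))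
  else (if p.1 = 1 then (1, p.2 + 1) else (p.1, p.2 - 1))

/-- Numbering of the star centres. -/
def code (p : Cell) : ℤ :=
  3 * (p.2 / 4) + (if p.2 % 4 = 0 then 0 else if p.2 % 4 = 2 then (if p.1 = 2 then 2 else 1)
    else if p.2 % 4 = 1 then 1 else 3)

theorem gmap_eq (n : ℕ) (i j k l : ℤ) : gmap n (i, j) = (k, l) ↔
    (j % 4 = 0 ∧ k = 1 ∧ l = j) ∨ (j % 4 = 2 ∧ i = 2 ∧ k = 2 ∧ l = j) ∨
    (j % 4 = 2 ∧ i ≠ 2 ∧ k = 0 ∧ l = j) ∨ (j % 2 = 1 ∧ j = n - 1 ∧ k = 1 ∧ l = j) ∨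
    (j % 4 = 1 ∧ j ≠ n - 1 ∧ i = 1 ∧ k = 1 ∧ l = j - 1) ∨
    (j % 4 = 1 ∧ j ≠ n - 1 ∧ i ≠ 1 ∧ k = i ∧ l = j + 1) ∨
    (j % 4 = 3 ∧ j ≠ n - 1 ∧ i = 1 ∧ k = 1 ∧ l = j + 1) ∨
    (j % 4 = 3 ∧ j ≠ n - 1 ∧ i ≠ 1 ∧ k = i ∧ l = j - 1) := by
  simp only [gmap]
  split_ifs <;> simp only [Prod.mk.injEq] <;> grind

theorem gmap_mem (n : ℕ) (p : Cell) (hp : p ∈ Rect 3 n) : gmap n p ∈ Rect 3 n := by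
  obtain ⟨i, j⟩ := p
  obtain ⟨⟨k, l⟩, h⟩ : ∃ c, gmap n (i, j) = c := ⟨_, rfl⟩
  rw [h]
  rw [gmap_eq] at h
  simp only [Rect, Set.mem_ofPred_eq] at *
  omega

theorem gmap_idem (n : ℕ) (p : Cell) (hp : p ∈ Rect 3 n) : gmap n (gmap n p) = gmap n p := by
  obtain ⟨i, j⟩ := p
  obtain ⟨⟨k, l⟩, h⟩ : ∃ c, gmap n (i, j) = c := ⟨_, rfl⟩
  rw [h, gmap_eq]
  rw [gmap_eq] at h
  simp only [Rect, Set.mem_ofPred_eq] at hp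
  rcases h with h | h | h | h | h | h | h | h <;> grind

theorem gmap_adj (n : ℕ) (p : Cell) (hp : p ∈ Rect 3 n) : p = gmap n p ∨ Adj p (gmap n p) := by
  obtain ⟨i, j⟩ := p
  obtain ⟨⟨k, l⟩, h⟩ : ∃ c, gmap n (i, j) = c := ⟨_, rfl⟩
  rw [h, adj_iff]
  rw [gmap_eq] at h
  simp only [Rect, Set.mem_ofPred_eq, Prod.mk.injEq] at *
  omega

theorem gmap_other (n : ℕ) (c : Cell) (hc : c ∈ Rect 3 n) (h : gmap n c = c) :
    ∃ q ∈ Rect 3 n, q ≠ c ∧ gmap n q = c := by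
  obtain ⟨i, j⟩ := c
  rw [gmap_eq] at h
  simp only [Rect, Set.mem_ofPred_eq] at hc
  by_cases h2 : j % 4 = 2
  · refine ⟨(i, j - 1), ?_, by simp, ?_⟩
    · simp only [Rect, Set.mem_ofPred_eq]; omega
    · rw [gmap_eq]
      rcases h with h | h | h | h | h | h | h | h <;> grind
  · refine ⟨(0, j), ?_, ?_, ?_⟩
    · simp only [Rect, Set.mem_ofPred_eq]; omega
    · simp only [ne_eq, Prod.mk.injEq]; omega
    · rw [gmap_eq]
      rcases h with h | h | h | h | h | h | h | h <;> grind

theorem code_lt (n : ℕ) (c : Cell) (hc : c ∈ Rect 3 n) (h : gmap n c = c) :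
    0 ≤ code c ∧ code c < ((3 * n + 4) / 4 : ℕ) := by
  obtain ⟨i, j⟩ := c
  simp only [Rect, Set.mem_ofPred_eq] at hc
  simp only [gmap, code] at *
  split_ifs at * <;> simp only [Prod.mk.injEq] at * <;> omega

theorem code_inj (n : ℕ) (c d : Cell) (hc : c ∈ Rect 3 n) (h : gmap n c = c)
    (hd : d ∈ Rect 3 n) (h' : gmap n d = d) (e : code c = code d) : c = d := by
  obtain ⟨i, j⟩ := c
  obtain ⟨k, l⟩ := d
  simp only [Rect, Set.mem_ofPred_eq] at hc hd
  simp only [gmap, code] at *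
  split_ifs at h <;> split_ifs at h' <;> simp only [Prod.mk.injEq] at * <;>
    split_ifs at e <;> omega

/-- The star centres. -/
noncomputable def centers (n : ℕ) : Finset Cell := (rectF n).filter (fun c => gmap n c = c)

theorem mem_centers (n : ℕ) (c : Cell) : c ∈ centers n ↔ c ∈ Rect 3 n ∧ gmap n c = c := by
  simp [centers, mem_rectF]

theorem card_centers (n : ℕ) : (centers n).card ≤ (3 * n + 4) / 4 := by
  have : (centers n).card ≤ (Finset.Ico (0 : ℤ) ((3 * n + 4) / 4 : ℕ)).card := by
    apply Finset.card_le_card_of_injOn code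
    · intro c hc
      obtain ⟨h1, h2⟩ := (mem_centers n c).1 hc
      exact Finset.mem_coe.2 (Finset.mem_Ico.2 (code_lt n c h1 h2))
    · intro c hc d hd e
      obtain ⟨h1, h2⟩ := (mem_centers n c).1 hc
      obtain ⟨h3, h4⟩ := (mem_centers n d).1 hd
      exact code_inj n c d h1 h2 h3 h4 e
  rw [Int.card_Ico] at this
  omega

/-! ### Fragment tilings -/

theorem exists_tiling_s17 (n : ℕ) :
    ∃ T : Finset (Set Cell), IsFragmentTiling (Rect 3 n) T ∧ T.card ≤ (3 * n + 4) / 4 := by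
  classical
  refine ⟨(centers n).image (fun c => {p | p ∈ Rect 3 n ∧ gmap n p = c}), ⟨?_, ?_, ?_⟩,
    Finset.card_image_le.trans (card_centers n)⟩
  · intro F hF
    obtain ⟨c, hc, rfl⟩ := Finset.mem_image.1 hF
    obtain ⟨h1, h2⟩ := (mem_centers n c).1 hc
    refine ⟨⟨c, ?_⟩, ?_, ?_⟩
    · rintro p ⟨hp, rfl⟩
      exact (mem_Xpent _ _).2 (gmap_adj n p hp)
    · obtain ⟨q, hq, hne, hqc⟩ := gmap_other n c h1 h2
      rw [← Set.ncard_pair hne]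
      apply Set.ncard_le_ncard
      · rintro y (rfl | rfl)
        · exact ⟨hq, hqc⟩
        · exact ⟨h1, h2⟩
      · refine (rectF n).finite_toSet.subset ?_
        rintro p ⟨hp, _⟩
        exact (mem_rectF n p).2 hp
    · intro p hp q hq
      apply Relation.ReflTransGen.trans (b := c)
      · rcases gmap_adj n p hp.1 with h | h
        · rw [hp.2] at h; rw [h]
        · rw [hp.2] at h
          exact Relation.ReflTransGen.single ⟨hp, ⟨h1, h2⟩, h⟩
      · rcases gmap_adj n q hq.1 with h | h
        · rw [hq.2] at h; rw [h]
        · rw [hq.2] at h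
          exact Relation.ReflTransGen.single ⟨⟨h1, h2⟩, hq, adj_symm h⟩
  · intro F hF G hG hne
    obtain ⟨c, hc, rfl⟩ := Finset.mem_image.1 hF
    obtain ⟨d, hd, rfl⟩ := Finset.mem_image.1 hG
    rw [Set.disjoint_left]
    rintro p ⟨_, rfl⟩ ⟨_, rfl⟩
    exact hne rfl
  · ext p
    simp only [Set.mem_iUnion, Finset.mem_image]
    constructor
    · rintro ⟨F, ⟨c, _, rfl⟩, hp⟩
      exact hp.1
    · intro hp
      exact ⟨_, ⟨gmap n p, (mem_centers n _).2 ⟨gmap_mem n p hp, gmap_idem n p hp⟩, rfl⟩, hp, rfl⟩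

theorem fragment_center (F : Set Cell) (hF : IsFragment F) :
    ∃ c ∈ F, ∀ p ∈ F, p = c ∨ Adj p c := by
  obtain ⟨⟨c, hc⟩, h2, hconn⟩ := hF
  refine ⟨c, ?_, fun p hp => (mem_Xpent c p).1 (hc hp)⟩
  by_contra hcF
  obtain ⟨p, hp, q, hq, hne⟩ := (Set.one_lt_ncard (Set.finite_of_ncard_pos (by omega))).1 h2
  rcases Relation.ReflTransGen.cases_head (hconn p hp q hq) with h | ⟨r, ⟨_, hr, hpr⟩, _⟩
  · exact hne h
  · have a1 := (mem_Xpent c p).1 (hc hp)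
    have a2 := (mem_Xpent c r).1 (hc hr)
    rcases a1 with rfl | a1
    · exact hcF hp
    rcases a2 with rfl | a2
    · exact hcF hr
    rw [adj_iff] at a1 a2 hpr
    omega

theorem tiling_lower (n : ℕ) (hn : 1 ≤ n) (T : Finset (Set Cell))
    (hT : IsFragmentTiling (Rect 3 n) T) : 3 * n + 1 ≤ 4 * T.card := by
  classical
  obtain ⟨hfrag, _, hun⟩ := hT
  have H : ∀ F : Set Cell, ∃ c : Cell, F ∈ T → c ∈ F ∧ ∀ p ∈ F, p = c ∨ Adj p c := by
    intro F
    by_cases h : F ∈ T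
    · obtain ⟨c, h1, h2⟩ := fragment_center F (hfrag F h)
      exact ⟨c, fun _ => ⟨h1, h2⟩⟩
    · exact ⟨(0, 0), fun h' => absurd h' h⟩
  choose f hf using H
  have := dom_lower n hn (T.image f) ⟨?_, ?_⟩
  · have h2 : (T.image f).card ≤ T.card := Finset.card_image_le
    omega
  · intro c hc
    obtain ⟨F, hF, rfl⟩ := Finset.mem_image.1 hc
    rw [← hun]
    exact Set.mem_biUnion hF (hf F hF).1
  · intro p hp
    rw [← hun] at hp
    simp only [Set.mem_iUnion] at hp
    obtain ⟨F, hF, hpF⟩ := hp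
    exact ⟨f F, Finset.mem_image_of_mem f hF, (hf F hF).2 p hpF⟩

/-! ### Saturated coverings -/

theorem exists_covering (n : ℕ) :
    ∃ D : Finset (Finset Cell), IsSaturatedCovering (Rect 3 n) D ∧
      3 * n - (3 * n + 4) / 4 ≤ D.card := by
  classical
  set L := rectF n \ centers n with hL
  have memL : ∀ p, p ∈ L ↔ p ∈ Rect 3 n ∧ gmap n p ≠ p := by
    intro p; simp only [hL, Finset.mem_sdiff, mem_rectF, mem_centers]; tauto
  have pin : ∀ p ∈ L, ∀ q ∈ L, p ∈ ({q, gmap n q} : Finset Cell) → p = q := by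
    intro p hp q hq h
    simp only [Finset.mem_insert, Finset.mem_singleton] at h
    rcases h with h | h
    · exact h
    · exfalso
      apply ((memL p).1 hp).2
      rw [h]
      exact gmap_idem n q ((memL q).1 hq).1
  have hcov : (⋃ e ∈ L.image (fun p => ({p, gmap n p} : Finset Cell)), (↑e : Set Cell))
      = Rect 3 n := by
    ext p
    simp only [Set.mem_iUnion, Finset.mem_image]
    constructor
    · rintro ⟨e, ⟨q, hq, rfl⟩, hp⟩
      have hq' := ((memL q).1 hq).1
      simp only [Finset.coe_insert, Finset.coe_singleton, Set.mem_insert_iff,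
        Set.mem_singleton_iff] at hp
      rcases hp with rfl | rfl
      · exact hq'
      · exact gmap_mem n q hq'
    · intro hp
      by_cases h : gmap n p = p
      · obtain ⟨q, hq, hne, hqp⟩ := gmap_other n p hp h
        exact ⟨_, ⟨q, (memL q).2 ⟨hq, by rw [hqp]; exact hne.symm⟩, rfl⟩, by simp [hqp]⟩
      · exact ⟨_, ⟨p, (memL p).2 ⟨hp, h⟩, rfl⟩, by simp⟩
  refine ⟨L.image (fun p => {p, gmap n p}), ⟨⟨?_, hcov⟩, ?_⟩, ?_⟩
  · intro e he
    obtain ⟨p, hp, rfl⟩ := Finset.mem_image.1 he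
    obtain ⟨h1, h2⟩ := (memL p).1 hp
    exact ⟨p, gmap n p, h1, gmap_mem n p h1,
      (gmap_adj n p h1).resolve_left (fun h => h2 h.symm), rfl⟩
  · intro e he
    obtain ⟨p, hp, rfl⟩ := Finset.mem_image.1 he
    rw [Set.ssubset_iff_of_subset]
    · refine ⟨p, ((memL p).1 hp).1, ?_⟩
      simp only [Set.mem_iUnion, not_exists]
      intro e he hpe
      obtain ⟨hne, he⟩ := Finset.mem_erase.1 he
      obtain ⟨q, hq, rfl⟩ := Finset.mem_image.1 he
      have := pin p hp q hq (Finset.mem_coe.1 hpe)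
      subst this
      exact hne rfl
    · rw [← hcov]
      exact Set.biUnion_subset_biUnion_left (fun e he => Finset.mem_of_mem_erase he)
  · rw [Finset.card_image_of_injOn]
    · have h1 := Finset.card_sdiff_add_card_eq_card (Finset.filter_subset (fun c => gmap n c = c) (rectF n))
      have h2 := card_centers n
      rw [card_rectF] at h1
      change L.card + (centers n).card = 3 * n at h1
      omega
    · intro p hp q hq h
      refine pin p hp q hq ?_
      have h' : ({p, gmap n p} : Finset Cell) = {q, gmap n q} := h
      rw [← h']; simp

theorem covering_upper (n : ℕ) (hn : 1 ≤ n) (D : Finset (Finset Cell))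
    (hD : IsSaturatedCovering (Rect 3 n) D) : 3 * n + 1 + 4 * D.card ≤ 4 * (3 * n) := by
  classical
  obtain ⟨⟨hdom, hun⟩, hsat⟩ := hD
  have H : ∀ e : Finset Cell, ∃ p : Cell, e ∈ D →
      p ∈ Rect 3 n ∧ p ∈ e ∧ ∀ e' ∈ D, p ∈ e' → e' = e := by
    intro e
    by_cases he : e ∈ D
    · obtain ⟨p, hp, hp'⟩ := Set.exists_of_ssubset (hsat e he)
      refine ⟨p, fun _ => ?_⟩
      have key : ∀ e' ∈ D, p ∈ e' → e' = e := by
        intro e' he' hpe'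
        by_contra hne
        exact hp' (Set.mem_biUnion (Finset.mem_coe.2 (Finset.mem_erase.2 ⟨hne, he'⟩)) hpe')
      refine ⟨hp, ?_, key⟩
      rw [← hun] at hp
      simp only [Set.mem_iUnion] at hp
      obtain ⟨e', he', hpe'⟩ := hp
      rw [← key e' he' hpe']
      exact hpe'
    · exact ⟨(0, 0), fun h => absurd h he⟩
  choose f hf using H
  have hinj : Set.InjOn f D := by
    intro e he e' he' h
    exact ((hf e' he').2.2 e he (h ▸ (hf e he).2.1))
  have hsub : D.image f ⊆ rectF n := by
    intro p hp
    obtain ⟨e, he, rfl⟩ := Finset.mem_image.1 hp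
    exact (mem_rectF n _).2 (hf e he).1
  have h1 := Finset.card_sdiff_add_card_eq_card hsub
  rw [Finset.card_image_of_injOn hinj, card_rectF] at h1
  have := dom_lower n hn (rectF n \ D.image f) ⟨?_, ?_⟩
  · omega
  · intro c hc
    exact (mem_rectF n c).1 (Finset.mem_sdiff.1 hc).1
  · intro p hp
    by_cases h : p ∈ D.image f
    · obtain ⟨e, he, rfl⟩ := Finset.mem_image.1 h
      obtain ⟨_, hmem, huniq⟩ := hf e he
      have other : ∃ q, q ∈ Rect 3 n ∧ q ∈ e ∧ Adj (f e) q := by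
        obtain ⟨a, b, ha, hb, hab, hE⟩ := hdom e he
        have h3 : f e = a ∨ f e = b := by
          have h4 := hmem
          rw [hE] at h4
          rw [hE]
          simpa using h4
        rcases h3 with h3 | h3
        · exact ⟨b, hb, by rw [hE]; simp, by rw [h3]; exact hab⟩
        · exact ⟨a, ha, by rw [hE]; simp, by rw [h3]; exact adj_symm hab⟩
      obtain ⟨q, hq, hqe, hadj⟩ := other
      refine ⟨q, Finset.mem_sdiff.2 ⟨(mem_rectF n q).2 hq, ?_⟩, Or.inr hadj⟩
      intro hqi
      obtain ⟨e', he', rfl⟩ := Finset.mem_image.1 hqi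
      have := (hf e' he').2.2 e he hqe
      subst this
      rw [adj_iff] at hadj
      omega
    · exact ⟨p, Finset.mem_sdiff.2 ⟨(mem_rectF n p).2 hp, h⟩, Or.inl rfl⟩

/-! ### The main theorem -/

theorem floor_formula (n : ℕ) : ⌊(3 * (n : ℚ) + 4) / 4⌋ = (((3 * n + 4) / 4 : ℕ) : ℤ) := by
  have := Rat.floor_natCast_div_natCast (3 * n + 4) 4
  push_cast at this ⊢
  exact this

/-- For `n ≥ 1`, `f(R₃ₙ) = ⌊(3n+4)/4⌋` and `d(R₃ₙ) = 3n − ⌊(3n+4)/4⌋`. -/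
theorem fNum_dNum_three_by_n (n : ℕ) (hn : 1 ≤ n) :
    (fNum (Rect 3 n) : ℤ) = ⌊(3 * (n : ℚ) + 4) / 4⌋ ∧
    (dNum (Rect 3 n) : ℤ) = 3 * (n : ℤ) - ⌊(3 * (n : ℚ) + 4) / 4⌋ := by
  rw [floor_formula]
  constructor
  · obtain ⟨T, hT, hc⟩ := exists_tiling_s17 n
    have h1 : fNum (Rect 3 n) ≤ T.card := Nat.sInf_le ⟨T, hT, rfl⟩
    have h2 : fNum (Rect 3 n) ∈
        {k : ℕ | ∃ T : Finset (Set Cell), IsFragmentTiling (Rect 3 n) T ∧ T.card = k} :=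
      Nat.sInf_mem ⟨_, T, hT, rfl⟩
    obtain ⟨T', hT', hc'⟩ := h2
    have h3 := tiling_lower n hn T' hT'
    omega
  · obtain ⟨D, hD, hc⟩ := exists_covering n
    have hb : ∀ k ∈ {k : ℕ | ∃ D : Finset (Finset Cell), IsSaturatedCovering (Rect 3 n) D ∧
        D.card = k}, k ≤ 3 * n - (3 * n + 4) / 4 := by
      rintro k ⟨D', hD', rfl⟩
      have := covering_upper n hn D' hD'
      omega
    have h1 : D.card ≤ dNum (Rect 3 n) := le_csSup ⟨_, hb⟩ ⟨D, hD, rfl⟩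
    have h2 : dNum (Rect 3 n) ≤ 3 * n - (3 * n + 4) / 4 := csSup_le ⟨_, D, hD, rfl⟩ hb
    omega
end

section
/- For every n ≥ 1, the 4 × n board R_{4,n} satisfies f(R_{4,n}) = n + 1 if n ∈ {1, 2, 3, 5, 6, 9}, and f(R_{4,n}) = n otherwise; correspondingly d(R_{4,n}) = 4n − f(R_{4,n}). -/
namespace FourByN

/-! ### A column automaton for domination of the `4 × n` grid -/

/-- Column state from four membership bits. -/
def mk (b0 b1 b2 b3 : Bool) : Fin 16 :=
  ⟨b0.toNat + 2 * b1.toNat + 4 * b2.toNat + 8 * b3.toNat, by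
    cases b0 <;> cases b1 <;> cases b2 <;> cases b3 <;> decide⟩

/-- Bit of a column state. -/
def bit (a : Fin 16) (r : ℕ) : Bool := a.val.testBit r

/-- Number of chosen cells in a column. -/
def cnt (a : Fin 16) : ℕ :=
  (bit a 0).toNat + (bit a 1).toNat + (bit a 2).toNat + (bit a 3).toNat

/-- The middle column is dominated. -/
def ok (a b c : Fin 16) : Bool :=
  (bit a 0 || bit b 0 || bit b 1 || bit c 0) &&
  (bit a 1 || bit b 1 || bit b 0 || bit b 2 || bit c 1) &&
  (bit a 2 || bit b 2 || bit b 1 || bit b 3 || bit c 2) &&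
  (bit a 3 || bit b 3 || bit b 2 || bit c 3)

/-- Potential (shifted by two), as a table indexed by two consecutive columns. -/
def potTable : List (List ℕ) :=
  [[0, 1, 2, 2, 2, 2, 2, 2, 1, 2, 2, 3, 2, 3, 2, 3],
   [0, 1, 2, 2, 2, 2, 2, 2, 2, 2, 2, 3, 2, 3, 2, 3],
   [1, 1, 2, 2, 2, 2, 2, 2, 2, 2, 2, 3, 2, 3, 2, 3],
   [1, 1, 2, 2, 2, 2, 2, 2, 2, 2, 2, 3, 2, 3, 2, 3],
   [1, 2, 2, 2, 2, 2, 2, 2, 1, 2, 2, 3, 2, 3, 2, 3],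
   [1, 2, 2, 2, 2, 2, 2, 2, 2, 2, 2, 3, 2, 3, 2, 3],
   [1, 2, 2, 2, 2, 2, 2, 2, 2, 2, 2, 3, 2, 3, 2, 3],
   [1, 2, 2, 2, 2, 2, 2, 2, 2, 2, 2, 3, 2, 3, 2, 3],
   [0, 2, 2, 2, 2, 2, 2, 2, 1, 2, 2, 3, 2, 3, 2, 3],
   [1, 2, 2, 2, 2, 2, 2, 2, 2, 2, 2, 3, 2, 3, 2, 3],
   [1, 2, 2, 2, 2, 2, 2, 2, 2, 2, 2, 3, 2, 3, 2, 3],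
   [2, 2, 2, 2, 2, 2, 2, 2, 2, 2, 2, 3, 2, 3, 2, 3],
   [1, 2, 2, 2, 2, 2, 2, 2, 1, 2, 2, 3, 2, 3, 2, 3],
   [2, 2, 2, 2, 2, 2, 2, 2, 2, 2, 2, 3, 2, 3, 2, 3],
   [1, 2, 2, 2, 2, 2, 2, 2, 2, 2, 2, 3, 2, 3, 2, 3],
   [2, 2, 2, 2, 2, 2, 2, 2, 2, 2, 2, 3, 2, 3, 2, 3]]

/-- Potential of a pair of consecutive columns. -/
def pot (a b : Fin 16) : ℕ := (potTable.getD a.val []).getD b.val 0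

theorem pot_step : ∀ a b c : Fin 16, ok a b c = true → pot b c + 1 ≤ cnt c + pot a b := by
  decide +kernel

theorem pot_end : ∀ a b : Fin 16, ok a b 0 = true → 2 ≤ pot a b := by
  decide +kernel

theorem bit_mk : ∀ b0 b1 b2 b3 : Bool, bit (mk b0 b1 b2 b3) 0 = b0 ∧
    bit (mk b0 b1 b2 b3) 1 = b1 ∧ bit (mk b0 b1 b2 b3) 2 = b2 ∧ bit (mk b0 b1 b2 b3) 3 = b3 := by
  decide +kernel

/-- Potential lower bound on the cost of a dominated sequence of columns. -/
theorem pot_bound (n : ℕ) : ∀ M : ℕ → Fin 16,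
    (∀ k ≤ n, ok (M k) (M (k + 1)) (M (k + 2)) = true) → M (n + 2) = 0 →
    n + 2 ≤ (∑ k ∈ Finset.range n, cnt (M (k + 2))) + pot (M 0) (M 1) := by
  induction n with
  | zero =>
    intro M h h0
    have := h 0 le_rfl
    simp only [Nat.zero_add] at this h0
    rw [h0] at this
    simpa using pot_end _ _ this
  | succ n ih =>
    intro M h h0
    have h1 := ih (fun k => M (k + 1)) (fun k hk => h (k + 1) (by omega)) h0
    have h2 := pot_step _ _ _ (h 0 (by omega))
    rw [Finset.sum_range_succ']
    simp only [Nat.zero_add, Nat.reduceAdd] at h1 h2 ⊢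
    have e : ∑ k ∈ Finset.range n, cnt (M (k + 2 + 1)) = ∑ k ∈ Finset.range n, cnt (M (k + 1 + 2)) := rfl
    omega

/-- Pruned search for a dominated completion with `r` further columns of cost at most `k`. -/
def search : ℕ → Fin 16 → Fin 16 → ℕ → Bool
  | 0, a, b, _ => ok a b 0
  | r + 1, a, b, k => (List.finRange 16).any fun c =>
      ok a b c && (decide (cnt c ≤ k) && (decide (r + 2 ≤ (k - cnt c) + pot b c) &&
        search r b c (k - cnt c)))

theorem search_sound (n : ℕ) : ∀ (M : ℕ → Fin 16) (k : ℕ),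
    (∀ k ≤ n, ok (M k) (M (k + 1)) (M (k + 2)) = true) → M (n + 2) = 0 →
    (∑ k ∈ Finset.range n, cnt (M (k + 2))) ≤ k → search n (M 0) (M 1) k = true := by
  induction n with
  | zero =>
    intro M k h h0 _
    have := h 0 le_rfl
    simp only [Nat.zero_add] at this h0
    rw [h0] at this
    exact this
  | succ n ih =>
    intro M k h h0 hk
    rw [Finset.sum_range_succ'] at hk
    have e : ∑ k ∈ Finset.range n, cnt (M (k + 2 + 1)) = ∑ k ∈ Finset.range n, cnt (M (k + 1 + 2)) := rfl
    have h1 := pot_bound n (fun k => M (k + 1)) (fun k hk => h (k + 1) (by omega)) h0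
    have h2 := ih (fun k => M (k + 1)) (k - cnt (M 2)) (fun k hk => h (k + 1) (by omega)) h0
      (by simp only [Nat.zero_add] at hk ⊢; omega)
    have h3 := h 0 (by omega)
    simp only [Nat.zero_add, Nat.reduceAdd] at h1 h2 h3 hk
    rw [search, List.any_eq_true]
    refine ⟨M 2, List.mem_finRange _, ?_⟩
    simp only [Bool.and_eq_true, decide_eq_true_eq]
    exact ⟨h3, by omega, by omega, h2⟩

theorem search_fail : ∀ n ∈ ({1, 2, 3, 5, 6, 9} : Finset ℕ), search n 15 0 n = false := by
  decide +kernel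

theorem ok_start : ∀ c : Fin 16, ok 15 0 c = true := by decide +kernel

/-- The claimed value of the domination number. -/
def g (n : ℕ) : ℕ := if n ∈ ({1, 2, 3, 5, 6, 9} : Finset ℕ) then n + 1 else n

theorem column_bound (n : ℕ) (M : ℕ → Fin 16) (h15 : M 0 = 15) (h00 : M 1 = 0)
    (h : ∀ k ≤ n, ok (M k) (M (k + 1)) (M (k + 2)) = true) (h0 : M (n + 2) = 0) :
    g n ≤ ∑ k ∈ Finset.range n, cnt (M (k + 2)) := by
  have hb := pot_bound n M h h0
  have hp : pot 15 0 = 2 := by decide +kernel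
  rw [h15, h00, hp] at hb
  unfold g
  split_ifs with hn
  · by_contra hc
    have := search_sound n M n h h0 (by omega)
    rw [h15, h00, search_fail n hn] at this
    exact absurd this (by decide)
  · omega

/-! ### From dominating sets to columns -/

theorem adj_cases {p q : Cell} (h : Adj p q) :
    (q.1 = p.1 + 1 ∧ q.2 = p.2) ∨ (q.1 = p.1 - 1 ∧ q.2 = p.2) ∨
    (q.1 = p.1 ∧ q.2 = p.2 + 1) ∨ (q.1 = p.1 ∧ q.2 = p.2 - 1) := by
  unfold Adj at h
  rcases abs_cases (p.1 - q.1) with ⟨h1, h1'⟩ | ⟨h1, h1'⟩ <;>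
  rcases abs_cases (p.2 - q.2) with ⟨h2, h2'⟩ | ⟨h2, h2'⟩ <;>
  rw [h1, h2] at h <;> omega

theorem adj_symm {p q : Cell} (h : Adj p q) : Adj q p := by
  unfold Adj at *
  rw [abs_sub_comm q.1, abs_sub_comm q.2]
  exact h

theorem adj_ne {p q : Cell} (h : Adj p q) : p ≠ q := by
  rintro rfl
  simp [Adj] at h

/-- `C` is a dominating subset of the `4 × n` board. -/
def Dominates (n : ℕ) (C : Finset Cell) : Prop :=
  (∀ p ∈ C, p ∈ Rect 4 n) ∧ ∀ p ∈ Rect 4 n, ∃ c ∈ C, p = c ∨ Adj p c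

/-- State of column `j`. -/
def col (C : Finset Cell) (j : ℤ) : Fin 16 :=
  mk (decide ((0, j) ∈ C)) (decide ((1, j) ∈ C)) (decide ((2, j) ∈ C)) (decide ((3, j) ∈ C))

theorem cnt_col (C : Finset Cell) (j : ℤ) :
    cnt (col C j) = ∑ r ∈ Finset.range 4, if ((r : ℤ), j) ∈ C then 1 else 0 := by
  obtain ⟨h0, h1, h2, h3⟩ := bit_mk (decide ((0, j) ∈ C)) (decide ((1, j) ∈ C))
    (decide ((2, j) ∈ C)) (decide ((3, j) ∈ C))
  unfold cnt col
  rw [h0, h1, h2, h3]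
  simp only [Finset.sum_range_succ, Finset.sum_range_zero, Bool.toNat, Bool.cond_decide]
  simp

theorem col_zero (C : Finset Cell) (j : ℤ) (h : ∀ r, (r, j) ∉ C) : col C j = 0 := by
  simp only [col, h, decide_false]
  decide

theorem sum_cnt_le (C : Finset Cell) (n : ℕ) :
    ∑ k ∈ Finset.range n, cnt (col C k) ≤ C.card := by
  simp only [cnt_col]
  rw [← Finset.sum_product' (Finset.range n) (Finset.range 4)
    (fun k r => if ((r : ℤ), (k : ℤ)) ∈ C then 1 else 0), ← Finset.card_filter]
  refine Finset.card_le_card_of_injOn (fun x => ((x.2 : ℤ), (x.1 : ℤ))) ?_ ?_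
  · intro x hx
    simpa using (Finset.mem_filter.mp hx).2
  · rintro ⟨a, b⟩ _ ⟨c, d⟩ _ h
    simpa [and_comm] using h

theorem dominates_bound (n : ℕ) (C : Finset Cell) (hC : Dominates n C) : g n ≤ C.card := by
  refine le_trans ?_ (sum_cnt_le C n)
  let M : ℕ → Fin 16 := fun k => if k = 0 then 15 else col C ((k : ℤ) - 2)
  have hM : ∀ k, M (k + 1) = col C ((k : ℤ) - 1) := by
    intro k
    simp only [M, Nat.succ_ne_zero, if_false]
    congr 1
    push_cast
    ring
  have hM2 : ∀ k, M (k + 2) = col C (k : ℤ) := by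
    intro k
    rw [hM (k + 1)]
    congr 1
    push_cast
    ring
  have h1 : M 1 = 0 := by
    rw [hM 0]
    apply col_zero
    intro r hr
    have := hC.1 _ hr
    simp [Rect] at this
  have key := column_bound n M rfl h1 ?_ ?_
  · simpa only [hM2] using key
  · intro k hk
    rcases k with _ | j
    · change ok 15 (M 1) _ = true
      rw [h1]
      exact ok_start _
    · have hj : j < n := by omega
      rw [hM, hM2, hM2]
      have hr : ∀ r : ℤ, 0 ≤ r → r < 4 → (r, (j : ℤ)) ∈ C ∨ (r + 1, (j : ℤ)) ∈ C ∨
          (r - 1, (j : ℤ)) ∈ C ∨ (r, (j : ℤ) + 1) ∈ C ∨ (r, (j : ℤ) - 1) ∈ C := by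
        intro r h0 h4
        obtain ⟨⟨c1, c2⟩, hc, he | ha⟩ := hC.2 (r, (j : ℤ)) (by
          simp only [Rect, Set.mem_ofPred_eq]; omega)
        · exact Or.inl (he ▸ hc)
        · have := adj_cases ha
          simp only at this
          rcases this with ⟨rfl, rfl⟩ | ⟨rfl, rfl⟩ | ⟨rfl, rfl⟩ | ⟨rfl, rfl⟩ <;> tauto
      have hm : ((-1 : ℤ), (j : ℤ)) ∉ C := fun h => by
        have := hC.1 _ h
        simp [Rect] at this
      have hp : ((4 : ℤ), (j : ℤ)) ∉ C := fun h => by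
        have := hC.1 _ h
        simp [Rect] at this
      have r0 := hr 0 (by norm_num) (by norm_num)
      have r1 := hr 1 (by norm_num) (by norm_num)
      have r2 := hr 2 (by norm_num) (by norm_num)
      have r3 := hr 3 (by norm_num) (by norm_num)
      norm_num [hm, hp] at r0 r1 r2 r3
      have e : ((j + 1 : ℕ) : ℤ) = (j : ℤ) + 1 := by push_cast; ring
      rw [e]
      simp only [ok, col, (bit_mk _ _ _ _).1, (bit_mk _ _ _ _).2.1, (bit_mk _ _ _ _).2.2.1,
        (bit_mk _ _ _ _).2.2.2, Bool.and_eq_true, Bool.or_eq_true, decide_eq_true_eq]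
      refine ⟨⟨⟨?_, ?_⟩, ?_⟩, ?_⟩
      · rcases r0 with h | h | h | h <;> simp [h]
      · rcases r1 with h | h | h | h | h <;> simp [h]
      · rcases r2 with h | h | h | h | h <;> simp [h]
      · rcases r3 with h | h | h | h <;> simp [h]
  · rw [hM2]
    apply col_zero
    intro r hr
    have := hC.1 _ hr
    simp [Rect] at this

/-! ### Tilings and coverings yield dominating sets -/

/-- The board as a finset. -/
noncomputable def RF (n : ℕ) : Finset Cell := Finset.Ico (0 : ℤ) 4 ×ˢ Finset.Ico (0 : ℤ) (n : ℤ)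

theorem mem_RF {n : ℕ} {p : Cell} : p ∈ RF n ↔ p ∈ Rect 4 n := by
  simp only [RF, Finset.mem_product, Finset.mem_Ico, Rect, Set.mem_ofPred_eq]
  push_cast
  tauto

theorem card_RF (n : ℕ) : (RF n).card = 4 * n := by
  simp [RF]

theorem mem_Xpent {p c : Cell} (h : p ∈ Xpent c) : p = c ∨ Adj p c := by
  obtain ⟨a, b⟩ := c
  simp only [Xpent, Set.mem_insert_iff, Set.mem_singleton_iff] at h
  rcases h with rfl | rfl | rfl | rfl | rfl <;> simp [Adj]

theorem Xpent_of {p c : Cell} (h : p = c ∨ Adj p c) : p ∈ Xpent c := by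
  rcases h with rfl | h
  · simp [Xpent]
  · obtain ⟨a, b⟩ := c
    obtain ⟨x, y⟩ := p
    have := adj_cases (adj_symm h)
    simp only [Xpent, Set.mem_insert_iff, Set.mem_singleton_iff, Prod.mk.injEq] at this ⊢
    tauto

theorem fragment_center {F : Set Cell} (hF : IsFragment F) : ∃ c ∈ F, F ⊆ Xpent c := by
  obtain ⟨⟨c, hc⟩, h2, hconn⟩ := hF
  by_cases hcF : c ∈ F
  · exact ⟨c, hcF, hc⟩
  exfalso
  obtain ⟨p, q, hp, hq, hpq⟩ := (Set.one_lt_ncard_iff (Set.finite_of_ncard_pos (by omega))).mp h2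
  rcases Relation.ReflTransGen.cases_head (hconn p hp q hq) with h | ⟨b, ⟨_, hb, hab⟩, _⟩
  · exact hpq h
  have h1 : Adj p c := (mem_Xpent (hc hp)).resolve_left (fun h => hcF (h ▸ hp))
  have h3 : Adj b c := (mem_Xpent (hc hb)).resolve_left (fun h => hcF (h ▸ hb))
  have h1 := adj_cases h1
  have h3 := adj_cases h3
  have h4 := adj_cases hab
  omega

theorem tiling_bound {n : ℕ} {T : Finset (Set Cell)} (hT : IsFragmentTiling (Rect 4 n) T) :
    g n ≤ T.card := by
  classical
  obtain ⟨hfr, -, hun⟩ := hT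
  have : ∀ F : Set Cell, ∃ c : Cell, F ∈ T → c ∈ F ∧ F ⊆ Xpent c := by
    intro F
    by_cases hF : F ∈ T
    · obtain ⟨c, h⟩ := fragment_center (hfr F hF)
      exact ⟨c, fun _ => h⟩
    · exact ⟨(0, 0), fun h => absurd h hF⟩
  choose ctr hctr using this
  refine le_trans (dominates_bound n (T.image ctr) ⟨?_, ?_⟩) Finset.card_image_le
  · intro p hp
    obtain ⟨F, hF, rfl⟩ := Finset.mem_image.mp hp
    rw [← hun]
    exact Set.mem_biUnion (t := fun F => F) hF (hctr F hF).1
  · intro p hp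
    rw [← hun] at hp
    obtain ⟨F, hF, hpF⟩ := Set.mem_iUnion₂.mp hp
    exact ⟨ctr F, Finset.mem_image_of_mem _ hF, mem_Xpent ((hctr F hF).2 hpF)⟩

theorem covering_bound {n : ℕ} {D : Finset (Finset Cell)}
    (hD : IsSaturatedCovering (Rect 4 n) D) : D.card + g n ≤ 4 * n := by
  classical
  obtain ⟨⟨hdom, hun⟩, hsat⟩ := hD
  have : ∀ e : Finset Cell, ∃ p : Cell, e ∈ D →
      p ∈ Rect 4 n ∧ p ∈ e ∧ ∀ e' ∈ D, p ∈ e' → e' = e := by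
    intro e
    by_cases he : e ∈ D
    · obtain ⟨p, hp, hp'⟩ := Set.exists_of_ssubset (hsat e he)
      have huniq : ∀ e' ∈ D, p ∈ e' → e' = e := by
        intro e' he' hpe'
        by_contra hne
        exact hp' (Set.mem_biUnion (t := fun e : Finset Cell => (e : Set Cell))
          (Finset.mem_erase.mpr ⟨hne, he'⟩) hpe')
      refine ⟨p, fun _ => ⟨hp, ?_, huniq⟩⟩
      rw [← hun] at hp
      obtain ⟨e', he', hpe'⟩ := Set.mem_iUnion₂.mp hp
      have := huniq e' he' hpe'
      exact this ▸ hpe'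
    · exact ⟨(0, 0), fun h => absurd h he⟩
  choose f hf using this
  have hinj : Set.InjOn f (D : Set (Finset Cell)) := by
    intro e he e' he' h
    have h2 := (hf e' he').2.1
    rw [← h] at h2
    exact ((hf e he).2.2 e' he' h2).symm
  have hsub : D.image f ⊆ RF n := by
    intro p hp
    obtain ⟨e, he, rfl⟩ := Finset.mem_image.mp hp
    exact mem_RF.mpr (hf e he).1
  have hcard : (RF n \ D.image f).card = 4 * n - D.card := by
    rw [Finset.card_sdiff_of_subset hsub, card_RF, Finset.card_image_of_injOn hinj]
  have hle : D.card ≤ 4 * n := by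
    rw [← card_RF n, ← Finset.card_image_of_injOn hinj]
    exact Finset.card_le_card hsub
  have hb := dominates_bound n (RF n \ D.image f) ⟨?_, ?_⟩
  · omega
  · intro p hp
    exact mem_RF.mp (Finset.mem_sdiff.mp hp).1
  · intro p hp
    by_cases hpi : p ∈ D.image f
    · obtain ⟨e, he, rfl⟩ := Finset.mem_image.mp hpi
      have key : ∀ x y : Cell, x ∈ Rect 4 n → Adj x y → e = {y, x} → f e = y →
          ∃ c ∈ RF n \ D.image f, f e = c ∨ Adj (f e) c := by
        intro x y hx hxy hexy hfy
        refine ⟨x, Finset.mem_sdiff.mpr ⟨mem_RF.mpr hx, ?_⟩, Or.inr (hfy ▸ adj_symm hxy)⟩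
        intro hxi
        obtain ⟨e', he', hfe'⟩ := Finset.mem_image.mp hxi
        have h3 := (hf e' he').2.2 e he (by rw [hfe', hexy]; simp)
        rw [← h3, hfy] at hfe'
        exact adj_ne hxy hfe'.symm
      obtain ⟨x, y, hx, hy, hxy, hexy⟩ := hdom e he
      have hmem := (hf e he).2.1
      rw [hexy, Finset.mem_insert, Finset.mem_singleton, ← hexy] at hmem
      rcases hmem with h | h
      · exact key y x hy (adj_symm hxy) hexy h
      · exact key x y hx hxy (by rw [hexy, Finset.pair_comm]) h
    · exact ⟨p, Finset.mem_sdiff.mpr ⟨mem_RF.mpr hp, hpi⟩, Or.inl rfl⟩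

/-! ### Star layouts and the constructions -/

/-- A partition of the board into `k` nontrivial stars: `C` are the centres and `π` sends each
cell to the centre of its star. -/
def Layout (n k : ℕ) (C : Finset Cell) (π : Cell → Cell) : Prop :=
  C.card = k ∧ (∀ c ∈ C, c ∈ RF n) ∧
  (∀ p ∈ RF n, π p ∈ C ∧ (p ∈ C → π p = p) ∧ (p ∉ C → Adj p (π p))) ∧
  ∀ c ∈ C, ∃ q ∈ RF n, q ∉ C ∧ π q = c

theorem layout_tiling {n k : ℕ} {C : Finset Cell} {π : Cell → Cell} (h : Layout n k C π) :
    ∃ T : Finset (Set Cell), IsFragmentTiling (Rect 4 n) T ∧ T.card = k := by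
  classical
  obtain ⟨hk, hC, hπ, hq⟩ := h
  have hfix : ∀ c ∈ C, π c = c := fun c hc => (hπ c (hC c hc)).2.1 hc
  have hadj : ∀ p ∈ RF n, p = π p ∨ Adj p (π p) := by
    intro p hp
    by_cases hpC : p ∈ C
    · exact Or.inl (hfix p hpC).symm
    · exact Or.inr ((hπ p hp).2.2 hpC)
  refine ⟨C.image (fun c => {p : Cell | p ∈ RF n ∧ π p = c}), ⟨?_, ?_, ?_⟩, ?_⟩
  · intro F hF
    obtain ⟨c, hc, rfl⟩ := Finset.mem_image.mp hF
    refine ⟨⟨c, ?_⟩, ?_, ?_⟩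
    · rintro p ⟨hp, rfl⟩
      exact Xpent_of (hadj p hp)
    · obtain ⟨q, hqR, hqC, hqc⟩ := hq c hc
      refine (Set.one_lt_ncard_iff ((RF n).finite_toSet.subset fun p hp => hp.1)).mpr
        ⟨c, q, ⟨hC c hc, hfix c hc⟩, ⟨hqR, hqc⟩, ?_⟩
      rintro rfl
      exact hqC hc
    · rintro p ⟨hp, hpc⟩ q ⟨hq', hqc⟩
      have hcF : c ∈ RF n ∧ π c = c := ⟨hC c hc, hfix c hc⟩
      have h1 := hadj p hp
      have h2 := hadj q hq'
      rw [hpc] at h1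
      rw [hqc] at h2
      refine Relation.ReflTransGen.trans (b := c) ?_ ?_
      · rcases h1 with rfl | h1
        · exact Relation.ReflTransGen.refl
        · exact Relation.ReflTransGen.single ⟨⟨hp, hpc⟩, hcF, h1⟩
      · rcases h2 with rfl | h2
        · exact Relation.ReflTransGen.refl
        · exact Relation.ReflTransGen.single ⟨hcF, ⟨hq', hqc⟩, adj_symm h2⟩
  · intro F hF G hG hne
    obtain ⟨c, hc, rfl⟩ := Finset.mem_image.mp hF
    obtain ⟨d, hd, rfl⟩ := Finset.mem_image.mp hG
    rw [Set.disjoint_left]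
    rintro p ⟨_, h1⟩ ⟨_, h2⟩
    exact hne (by rw [← h1, ← h2])
  · ext p
    constructor
    · intro hp
      obtain ⟨F, hF, hpF⟩ := Set.mem_iUnion₂.mp hp
      obtain ⟨c, hc, rfl⟩ := Finset.mem_image.mp hF
      exact mem_RF.mp hpF.1
    · intro hp
      have hp' := mem_RF.mpr hp
      exact Set.mem_biUnion (t := fun F => F)
        (Finset.mem_image_of_mem (fun c => {p : Cell | p ∈ RF n ∧ π p = c}) (hπ p hp').1)
        ⟨hp', rfl⟩
  · rw [Finset.card_image_of_injOn, hk]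
    intro c hc d hd hcd
    have hmem : c ∈ {p : Cell | p ∈ RF n ∧ π p = c} := ⟨hC c hc, hfix c hc⟩
    have hcd' : {p : Cell | p ∈ RF n ∧ π p = c} = {p : Cell | p ∈ RF n ∧ π p = d} := hcd
    rw [hcd'] at hmem
    rw [← hmem.2, hfix c hc]

theorem layout_covering {n k : ℕ} {C : Finset Cell} {π : Cell → Cell} (h : Layout n k C π) :
    ∃ D : Finset (Finset Cell), IsSaturatedCovering (Rect 4 n) D ∧ D.card = 4 * n - k := by
  classical
  obtain ⟨hk, hC, hπ, hq⟩ := h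
  have hmem : ∀ e ∈ (RF n \ C).image (fun p => ({p, π p} : Finset Cell)),
      ∃ p ∈ RF n, p ∉ C ∧ e = {p, π p} := by
    intro e he
    obtain ⟨p, hp, rfl⟩ := Finset.mem_image.mp he
    exact ⟨p, (Finset.mem_sdiff.mp hp).1, (Finset.mem_sdiff.mp hp).2, rfl⟩
  have hpair : ∀ p ∈ RF n, p ∉ C → ∀ p' ∈ RF n, p ∈ ({p', π p'} : Finset Cell) → p = p' := by
    intro p _ hpC p' hp' hpp
    rcases Finset.mem_insert.mp hpp with h | h
    · exact h
    · rw [Finset.mem_singleton] at h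
      exact absurd (h ▸ (hπ p' hp').1) hpC
  have hun : (⋃ e ∈ (RF n \ C).image (fun p => ({p, π p} : Finset Cell)), (↑e : Set Cell))
      = Rect 4 n := by
    ext p
    constructor
    · intro hp
      obtain ⟨e, he, hpe⟩ := Set.mem_iUnion₂.mp hp
      obtain ⟨q, hqR, hqC, rfl⟩ := hmem e he
      rw [Finset.mem_coe, Finset.mem_insert, Finset.mem_singleton] at hpe
      rw [← mem_RF]
      rcases hpe with rfl | rfl
      · exact hqR
      · exact hC _ (hπ q hqR).1
    · intro hp
      have hp' := mem_RF.mpr hp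
      have main : ∀ q ∈ RF n, q ∉ C → p ∈ ({q, π q} : Finset Cell) →
          p ∈ (⋃ e ∈ (RF n \ C).image (fun p => ({p, π p} : Finset Cell)), (↑e : Set Cell)) := by
        intro q hqR hqC hpq
        exact Set.mem_biUnion (t := fun e : Finset Cell => (e : Set Cell))
          (Finset.mem_image_of_mem (fun p => ({p, π p} : Finset Cell))
            (Finset.mem_sdiff.mpr ⟨hqR, hqC⟩)) hpq
      by_cases hpC : p ∈ C
      · obtain ⟨q, hqR, hqC, hqp⟩ := hq p hpC
        exact main q hqR hqC (by simp [hqp])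
      · exact main p hp' hpC (by simp)
  refine ⟨(RF n \ C).image (fun p => ({p, π p} : Finset Cell)), ⟨⟨?_, hun⟩, ?_⟩, ?_⟩
  · intro e he
    obtain ⟨p, hpR, hpC, rfl⟩ := hmem e he
    exact ⟨p, π p, mem_RF.mp hpR, mem_RF.mp (hC _ (hπ p hpR).1), (hπ p hpR).2.2 hpC, rfl⟩
  · intro e he
    rw [Set.ssubset_iff_of_subset]
    · obtain ⟨p, hpR, hpC, rfl⟩ := hmem e he
      refine ⟨p, mem_RF.mp hpR, ?_⟩
      intro hp
      obtain ⟨e', he', hpe'⟩ := Set.mem_iUnion₂.mp hp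
      obtain ⟨hne, he'⟩ := Finset.mem_erase.mp he'
      obtain ⟨p', hpR', hpC', rfl⟩ := hmem e' he'
      have := hpair p hpR hpC p' hpR' hpe'
      subst this
      exact hne rfl
    · rw [← hun]
      exact Set.biUnion_subset_biUnion_left fun x hx => Finset.mem_of_mem_erase hx
  · rw [Finset.card_image_of_injOn, Finset.card_sdiff_of_subset hC, card_RF, hk]
    intro p hp p' hp' hpp
    rw [Finset.mem_coe, Finset.mem_sdiff] at hp hp'
    have hpp' : ({p, π p} : Finset Cell) = {p', π p'} := hpp
    exact hpair p hp.1 hp.2 p' hp'.1 (hpp' ▸ Finset.mem_insert_self _ _)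

/-- Two layouts side by side. -/
theorem layout_append {a b k l : ℕ} (h1 : ∃ C π, Layout a k C π) (h2 : ∃ C π, Layout b l C π) :
    ∃ C π, Layout (a + b) (k + l) C π := by
  classical
  obtain ⟨C, π, hk, hC, hπ, hq⟩ := h1
  obtain ⟨C', π', hk', hC', hπ', hq'⟩ := h2
  let s : Cell → Cell := fun p => (p.1, p.2 + a)
  let u : Cell → Cell := fun p => (p.1, p.2 - a)
  have hsu : ∀ p, s (u p) = p := fun p => by simp [s, u]
  have hus : ∀ p, u (s p) = p := fun p => by simp [s, u]
  have hs : Function.Injective s := fun p q h => by rw [← hus p, h, hus]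
  have hadj : ∀ p q, Adj p q → Adj (s p) (s q) := by
    intro p q h
    simpa [Adj, s] using h
  have mRF : ∀ (m : ℕ) (p : Cell), p ∈ RF m ↔ 0 ≤ p.1 ∧ p.1 < 4 ∧ 0 ≤ p.2 ∧ p.2 < m := by
    intro m p
    rw [mem_RF]
    simp [Rect]
  have lt_of : ∀ p ∈ RF a, p.2 < (a : ℤ) := fun p hp => ((mRF a p).mp hp).2.2.2
  have ge_of : ∀ p ∈ RF b, ¬ (s p).2 < (a : ℤ) := fun p hp => by
    have := (mRF b p).mp hp
    simp only [s]
    omega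
  have hsplit : ∀ p ∈ RF (a + b), p ∈ RF a ∨ ∃ q ∈ RF b, p = s q := by
    intro p hp
    rw [mRF] at hp
    push_cast at hp
    by_cases h : p.2 < a
    · left
      rw [mRF]
      omega
    · right
      refine ⟨u p, ?_, (hsu p).symm⟩
      rw [mRF]
      simp only [u]
      omega
  have inl : ∀ p ∈ RF a, p ∈ RF (a + b) := by
    intro p hp
    rw [mRF] at hp ⊢
    push_cast
    omega
  have inr : ∀ p ∈ RF b, s p ∈ RF (a + b) := by
    intro p hp
    rw [mRF] at hp ⊢
    push_cast
    simp only [s]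
    omega
  have disj : ∀ p ∈ RF a, ∀ q ∈ RF b, p ≠ s q := by
    rintro p hp q hq rfl
    exact ge_of q hq (lt_of _ hp)
  have memL : ∀ p ∈ RF a, p ∈ C ∪ C'.image s ↔ p ∈ C := by
    intro p hp
    rw [Finset.mem_union, Finset.mem_image]
    constructor
    · rintro (h | ⟨q, hq, rfl⟩)
      · exact h
      · exact absurd rfl (disj _ hp q (hC' q hq))
    · exact Or.inl
  have memR : ∀ p ∈ RF b, s p ∈ C ∪ C'.image s ↔ p ∈ C' := by
    intro p hp
    rw [Finset.mem_union, Finset.mem_image]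
    constructor
    · rintro (h | ⟨q, hq, h⟩)
      · exact absurd rfl (disj _ (hC _ h) p hp)
      · exact hs h ▸ hq
    · exact fun h => Or.inr ⟨p, h, rfl⟩
  let ρ : Cell → Cell := fun p => if p.2 < (a : ℤ) then π p else s (π' (u p))
  have ρL : ∀ p ∈ RF a, ρ p = π p := fun p hp => if_pos (lt_of p hp)
  have ρR : ∀ p ∈ RF b, ρ (s p) = s (π' p) := fun p hp => by
    simp only [ρ, if_neg (ge_of p hp), hus]
  refine ⟨C ∪ C'.image s, ρ, ?_, ?_, ?_, ?_⟩
  · rw [Finset.card_union_of_disjoint, Finset.card_image_of_injective _ hs, hk, hk']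
    rw [Finset.disjoint_left]
    intro p hp hp'
    obtain ⟨q, hq, rfl⟩ := Finset.mem_image.mp hp'
    exact disj _ (hC _ hp) q (hC' q hq) rfl
  · intro c hc
    rcases Finset.mem_union.mp hc with h | h
    · exact inl c (hC c h)
    · obtain ⟨q, hq, rfl⟩ := Finset.mem_image.mp h
      exact inr q (hC' q hq)
  · intro p hp
    rcases hsplit p hp with h | ⟨q, h, rfl⟩
    · rw [memL p h, ρL p h, memL _ (hC _ (hπ p h).1)]
      exact hπ p h
    · rw [memR q h, ρR q h, memR _ (hC' _ (hπ' q h).1)]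
      obtain ⟨x, y, z⟩ := hπ' q h
      exact ⟨x, fun hq => by rw [y hq], fun hq => hadj _ _ (z hq)⟩
  · intro c hc
    rcases Finset.mem_union.mp hc with h | h
    · obtain ⟨q, hqR, hqC, rfl⟩ := hq c h
      exact ⟨q, inl q hqR, fun h => hqC ((memL q hqR).mp h), ρL q hqR⟩
    · obtain ⟨d, hd, rfl⟩ := Finset.mem_image.mp h
      obtain ⟨q, hqR, hqC, rfl⟩ := hq' d hd
      exact ⟨s q, inr q hqR, fun h => hqC ((memR q hqR).mp h), ρR q hqR⟩

/-- Entry of a direction table at a cell. -/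
def code (t : List (List ℕ)) (p : Cell) : ℕ := (t.getD p.1.toNat []).getD p.2.toNat 0

/-- Follow the direction stored at a cell: 0 stay, 1 down, 2 up, 3 right, 4 left. -/
def follow (t : List (List ℕ)) (p : Cell) : Cell :=
  match code t p with
  | 0 => p
  | 1 => (p.1 + 1, p.2)
  | 2 => (p.1 - 1, p.2)
  | 3 => (p.1, p.2 + 1)
  | _ => (p.1, p.2 - 1)

/-- Centres of a direction table. -/
noncomputable def centers (t : List (List ℕ)) (n : ℕ) : Finset Cell := (RF n).filter fun p => code t p = 0

/-- Decidable check that a direction table is a layout. -/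
def Check (t : List (List ℕ)) (n k : ℕ) : Prop :=
  (centers t n).card = k ∧
  (∀ p ∈ RF n, follow t p ∈ RF n ∧ code t (follow t p) = 0 ∧ code t p ≤ 4) ∧
  ∀ c ∈ RF n, code t c = 0 → ∃ q ∈ RF n, code t q ≠ 0 ∧ follow t q = c

noncomputable instance (t : List (List ℕ)) (n k : ℕ) : Decidable (Check t n k) := by
  unfold Check
  infer_instance

theorem layout_of_check {t : List (List ℕ)} {n k : ℕ} (h : Check t n k) :
    ∃ C π, Layout n k C π := by
  obtain ⟨h1, h2, h3⟩ := h
  have hm : ∀ p, p ∈ centers t n ↔ p ∈ RF n ∧ code t p = 0 := fun p => by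
    simp [centers]
  refine ⟨centers t n, follow t, h1, fun c hc => ((hm c).mp hc).1, ?_, ?_⟩
  · intro p hp
    obtain ⟨ha, hb, hc⟩ := h2 p hp
    refine ⟨(hm _).mpr ⟨ha, hb⟩, ?_, ?_⟩
    · intro h
      have := ((hm p).mp h).2
      simp [follow, this]
    · intro h
      have hne : code t p ≠ 0 := fun h0 => h ((hm p).mpr ⟨hp, h0⟩)
      have hcase : code t p = 1 ∨ code t p = 2 ∨ code t p = 3 ∨ code t p = 4 := by omega
      rcases hcase with h | h | h | h <;> simp [follow, h, Adj]
  · intro c hc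
    obtain ⟨hcR, hc0⟩ := (hm c).mp hc
    obtain ⟨q, hq, hq0, hqc⟩ := h3 c hcR hc0
    exact ⟨q, hq, fun h => hq0 ((hm q).mp h).2, hqc⟩

theorem layout_1 : ∃ C π, Layout 1 2 C π :=
  layout_of_check (t := [[0], [2], [0], [2]]) (by decide +kernel)

theorem layout_2 : ∃ C π, Layout 2 3 C π :=
  layout_of_check (t := [[0, 4], [2, 1], [3, 0], [3, 0]]) (by decide +kernel)

theorem layout_3 : ∃ C π, Layout 3 4 C π :=
  layout_of_check (t := [[3, 0, 4], [3, 0, 4], [3, 0, 4], [3, 0, 4]]) (by decide +kernel)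

theorem layout_4 : ∃ C π, Layout 4 4 C π :=
  layout_of_check (t := [[1, 3, 0, 4], [0, 4, 2, 1], [2, 1, 3, 0], [3, 0, 4, 2]])
    (by decide +kernel)

theorem layout_7 : ∃ C π, Layout 7 7 C π :=
  layout_of_check (t := [[1, 3, 0, 3, 0, 4, 1], [0, 4, 2, 1, 2, 3, 0], [2, 1, 3, 0, 4, 1, 2],
    [3, 0, 4, 2, 3, 0, 4]]) (by decide +kernel)

theorem layout_10 : ∃ C π, Layout 10 10 C π :=
  layout_of_check (t := [[1, 3, 0, 3, 0, 4, 1, 3, 0, 4], [0, 4, 2, 1, 2, 3, 0, 4, 2, 1],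
    [2, 1, 3, 0, 4, 1, 2, 1, 3, 0], [3, 0, 4, 2, 3, 0, 3, 0, 4, 2]]) (by decide +kernel)

theorem layout_13 : ∃ C π, Layout 13 13 C π :=
  layout_of_check (t := [[1, 3, 0, 3, 0, 4, 1, 3, 0, 3, 0, 4, 1],
    [0, 4, 2, 1, 2, 3, 0, 4, 2, 1, 2, 3, 0], [2, 1, 3, 0, 4, 1, 2, 1, 3, 0, 4, 1, 2],
    [3, 0, 4, 2, 3, 0, 3, 0, 4, 2, 3, 0, 4]]) (by decide +kernel)

theorem layout_exists (n : ℕ) (hn : 1 ≤ n) : ∃ C π, Layout n (g n) C π := by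
  induction n using Nat.strong_induction_on with
  | _ n ih =>
    have step : 5 ≤ n → g n = g (n - 4) + 4 → ∃ C π, Layout n (g n) C π := by
      intro h5 hg
      have := layout_append (ih (n - 4) (by omega) (by omega)) layout_4
      rwa [Nat.sub_add_cancel (by omega), ← hg] at this
    by_cases h : 14 ≤ n
    · apply step (by omega)
      unfold g
      rw [if_neg, if_neg]
      · omega
      · simp only [Finset.mem_insert, Finset.mem_singleton]
        omega
      · simp only [Finset.mem_insert, Finset.mem_singleton]
        omega
    · have h13 : n ≤ 13 := by omega
      clear h
      interval_cases n
      · exact layout_1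
      · exact layout_2
      · exact layout_3
      · exact layout_4
      · exact step (by omega) (by decide)
      · exact step (by omega) (by decide)
      · exact layout_7
      · exact step (by omega) (by decide)
      · exact step (by omega) (by decide)
      · exact layout_10
      · exact step (by omega) (by decide)
      · exact step (by omega) (by decide)
      · exact layout_13

theorem fNum_eq (n : ℕ) (hn : 1 ≤ n) : fNum (Rect 4 n) = g n := by
  obtain ⟨C, π, h⟩ := layout_exists n hn
  have hT := layout_tiling h
  apply le_antisymm
  · exact Nat.sInf_le hT
  · refine le_csInf ⟨_, hT⟩ ?_
    rintro k ⟨T, hT, rfl⟩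
    exact tiling_bound hT

theorem dNum_eq (n : ℕ) (hn : 1 ≤ n) : dNum (Rect 4 n) = 4 * n - g n := by
  obtain ⟨C, π, h⟩ := layout_exists n hn
  have hD := layout_covering h
  have hub : ∀ k ∈ {k : ℕ | ∃ D : Finset (Finset Cell),
      IsSaturatedCovering (Rect 4 n) D ∧ D.card = k}, k ≤ 4 * n - g n := by
    rintro k ⟨D, hD, rfl⟩
    have := covering_bound hD
    omega
  apply le_antisymm
  · exact csSup_le ⟨_, hD⟩ hub
  · exact le_csSup ⟨_, hub⟩ hD

end FourByN

/-- For `n ≥ 1`, `f(R₄ₙ) = n + 1` if `n ∈ {1, 2, 3, 5, 6, 9}` and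
`f(R₄ₙ) = n` otherwise; correspondingly `d(R₄ₙ) = 4n − f(R₄ₙ)`. -/
theorem fNum_dNum_four_by_n (n : ℕ) (hn : 1 ≤ n) :
    (fNum (Rect 4 n) = if n ∈ ({1, 2, 3, 5, 6, 9} : Finset ℕ) then n + 1 else n) ∧
    dNum (Rect 4 n) = 4 * n - fNum (Rect 4 n) := by
  exact ⟨FourByN.fNum_eq n hn, by rw [FourByN.fNum_eq n hn]; exact FourByN.dNum_eq n hn⟩
end
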